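/- arXiv:1804.07466 — 5 statements merged into one kernel-verified Lean document; each statement's English description precedes it below -/
import Mathlib

section
/- Let 𝒜, ℬ, 𝒞 be mutually independent sub-σ-algebras of ℱ, and set 𝒢¹ := 𝒜 ⊔ 𝒞 and 𝒢² := ℬ ⊔ 𝒞. Then for every integrable real-valued random variable ξ on (Ω, ℱ, μ), μ-almost surely 𝔼[ 𝔼[ξ | 𝒢¹] | 𝒢² ] = 𝔼[ξ | 𝒞]. (In the paper's notation, the double filtering estimate ξ̂̌ of a random variable equals its conditional expectation given the common information σ-algebra.) -/
namespace MeasureTheory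

variable {Ω E : Type*} [NormedAddCommGroup E] [NormedSpace ℝ E]

/-- The sets `s ∩ t` with `s` measurable for `m₁` and `t` measurable for `m₂` generate
`m₁ ⊔ m₂`. -/
theorem generateFrom_image2_inter_measurableSet (m₁ m₂ : MeasurableSpace Ω) :
    MeasurableSpace.generateFrom
      (Set.image2 (· ∩ ·) {s | MeasurableSet[m₁] s} {t | MeasurableSet[m₂] t}) = m₁ ⊔ m₂ := by
  apply le_antisymm
  · refine MeasurableSpace.generateFrom_le ?_
    rintro _ ⟨s, hs, t, ht, rfl⟩
    exact MeasurableSet.inter (le_sup_left (a := m₁) (b := m₂) s hs)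
      (le_sup_right (a := m₁) (b := m₂) t ht)
  · refine sup_le (fun s hs ↦ ?_) (fun t ht ↦ ?_)
    · exact MeasurableSpace.measurableSet_generateFrom
        ⟨s, hs, Set.univ, @MeasurableSet.univ _ m₂, Set.inter_univ s⟩
    · exact MeasurableSpace.measurableSet_generateFrom
        ⟨Set.univ, @MeasurableSet.univ _ m₁, t, ht, Set.univ_inter t⟩

theorem isPiSystem_image2_inter_measurableSet (m₁ m₂ : MeasurableSpace Ω) :
    IsPiSystem (Set.image2 (· ∩ ·) {s | MeasurableSet[m₁] s} {t | MeasurableSet[m₂] t}) := by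
  rintro _ ⟨s, hs, t, ht, rfl⟩ _ ⟨s', hs', t', ht', rfl⟩ -
  exact ⟨s ∩ s', @MeasurableSet.inter _ m₁ _ _ hs hs', t ∩ t', @MeasurableSet.inter _ m₂ _ _ ht ht',
    Set.inter_inter_inter_comm s s' t t'⟩

/-- Two integrable functions whose integrals agree on the whole space and on a π-system have the
same integral over each set of the σ-algebra generated by the π-system. -/
theorem setIntegral_eq_of_isPiSystem {m mΩ : MeasurableSpace Ω} {μ : Measure Ω} {f g : Ω → E}
    {S : Set (Set Ω)} (hm : m ≤ mΩ) (hmS : m = MeasurableSpace.generateFrom S)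
    (hS : IsPiSystem S) (hf : Integrable f μ) (hg : Integrable g μ)
    (h_univ : ∫ ω, f ω ∂μ = ∫ ω, g ω ∂μ)
    (h : ∀ s ∈ S, ∫ ω in s, f ω ∂μ = ∫ ω in s, g ω ∂μ) {s : Set Ω} (hs : MeasurableSet[m] s) :
    ∫ ω in s, f ω ∂μ = ∫ ω in s, g ω ∂μ := by
  induction s, hs using MeasurableSpace.induction_on_inter hmS hS with
  | empty => simp
  | basic t ht => exact h t ht
  | compl t ht ih =>
    have hf' := integral_add_compl (hm t ht) hf
    have hg' := integral_add_compl (hm t ht) hg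
    rw [ih, h_univ, ← hg'] at hf'
    exact add_left_cancel hf'
  | iUnion t hd ht ih =>
    rw [integral_iUnion (fun i ↦ hm _ (ht i)) hd hf.integrableOn,
      integral_iUnion (fun i ↦ hm _ (ht i)) hd hg.integrableOn]
    exact tsum_congr ih

variable [CompleteSpace E]

/-- The integral of an `m₁`-measurable function over a set of an independent σ-algebra
factorizes. -/
theorem setIntegral_eq_measureReal_smul_integral_of_indep {m₁ m₂ mΩ : MeasurableSpace Ω}
    {μ : Measure Ω} [IsProbabilityMeasure μ] {f : Ω → E} (hm₁ : m₁ ≤ mΩ) (hm₂ : m₂ ≤ mΩ)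
    (hindep : ProbabilityTheory.Indep m₁ m₂ μ) (hfm : StronglyMeasurable[m₁] f)
    (hf : Integrable f μ) {s : Set Ω} (hs : MeasurableSet[m₂] s) :
    ∫ ω in s, f ω ∂μ = μ.real s • ∫ ω, f ω ∂μ := by
  rw [← setIntegral_condExp hm₂ hf hs,
    setIntegral_congr_ae (hm₂ s hs)
      ((condExp_indep_eq hm₁ hm₂ hfm hindep).mono fun _ h _ ↦ h), setIntegral_const]

/-- Conditioning an `m₁`-measurable function on `m₂ ⊔ m`, where `m₂` is independent of `m₁` and
`m ≤ m₁`, amounts to conditioning it on `m`. -/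
theorem condExp_sup_eq_condExp_of_indep {m m₁ m₂ mΩ : MeasurableSpace Ω}
    {μ : Measure Ω} [IsProbabilityMeasure μ] {f : Ω → E} (hm₁ : m₁ ≤ mΩ) (hm₂ : m₂ ≤ mΩ)
    (hm : m ≤ m₁) (hindep : ProbabilityTheory.Indep m₁ m₂ μ) (hfm : StronglyMeasurable[m₁] f)
    (hf : Integrable f μ) :
    μ[f | m₂ ⊔ m] =ᵐ[μ] μ[f | m] := by
  have hmΩ : m ≤ mΩ := hm.trans hm₁
  have hsup : m₂ ⊔ m ≤ mΩ := sup_le hm₂ hmΩ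
  refine (ae_eq_condExp_of_forall_setIntegral_eq hsup hf
    (fun _ _ _ ↦ integrable_condExp.integrableOn) (fun s hs _ ↦ ?_)
    (stronglyMeasurable_condExp.mono (le_sup_right : m ≤ m₂ ⊔ m)).aestronglyMeasurable).symm
  refine setIntegral_eq_of_isPiSystem hsup (generateFrom_image2_inter_measurableSet m₂ m).symm
    (isPiSystem_image2_inter_measurableSet m₂ m) integrable_condExp hf (integral_condExp hmΩ)
    ?_ hs
  rintro _ ⟨t, ht, u, hu, rfl⟩
  have key {g : Ω → E} (hgm : StronglyMeasurable[m₁] g) (hg : Integrable g μ) :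
      ∫ ω in t ∩ u, g ω ∂μ = μ.real t • ∫ ω in u, g ω ∂μ := by
    rw [← setIntegral_indicator (hmΩ u hu), ← integral_indicator (hmΩ u hu)]
    exact setIntegral_eq_measureReal_smul_integral_of_indep hm₁ hm₂ hindep
      (hgm.indicator (hm u hu)) (hg.indicator (hmΩ u hu)) ht
  change ∫ ω in t ∩ u, (μ[f | m]) ω ∂μ = ∫ ω in t ∩ u, f ω ∂μ
  rw [key (stronglyMeasurable_condExp.mono hm) integrable_condExp, key hfm hf,
    setIntegral_condExp hmΩ hf hu]

end MeasureTheory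

open MeasureTheory

/-- With `𝒜, ℬ, 𝒞` mutually independent, the double filtering estimate
`𝔼[𝔼[ξ | 𝒜 ⊔ 𝒞] | ℬ ⊔ 𝒞]` equals the conditional expectation given the common
information `𝒞`. -/
theorem double_filter_eq_condexp_common
    {Ω : Type*} (𝒜 ℬ 𝒞 : MeasurableSpace Ω) [mΩ : MeasurableSpace Ω]
    {μ : Measure Ω} [IsProbabilityMeasure μ]
    (h𝒜 : 𝒜 ≤ mΩ) (hℬ : ℬ ≤ mΩ) (h𝒞 : 𝒞 ≤ mΩ)
    (hindep : ProbabilityTheory.iIndep ![𝒜, ℬ, 𝒞] μ)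
    (ξ : Ω → ℝ) (hξ : Integrable ξ μ) :
    μ[μ[ξ | 𝒜 ⊔ 𝒞] | ℬ ⊔ 𝒞] =ᵐ[μ] μ[ξ | 𝒞] := by
  have hle : ∀ i, ![𝒜, ℬ, 𝒞] i ≤ mΩ := by
    intro i
    fin_cases i <;> assumption
  have hind : ProbabilityTheory.Indep (𝒜 ⊔ 𝒞) ℬ μ := by
    have h := ProbabilityTheory.indep_iSup_of_disjoint hle hindep
      (S := {0, 2}) (T := {1}) (by simp)
    simpa [iSup_or, iSup_sup_eq] using h
  exact (condExp_sup_eq_condExp_of_indep (sup_le h𝒜 h𝒞) hℬ le_sup_right hind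
    stronglyMeasurable_condExp integrable_condExp).trans
    (condExp_condExp_of_le le_sup_right (sup_le h𝒜 h𝒞))
end

section
/- Let 𝒜, ℬ, 𝒞 be mutually independent sub-σ-algebras of ℱ, and set 𝒢¹ := 𝒜 ⊔ 𝒞 and 𝒢² := ℬ ⊔ 𝒞. Then for every integrable real-valued random variable ξ, the two iterated conditional expectations agree: μ-almost surely, 𝔼[ 𝔼[ξ | 𝒢¹] | 𝒢² ] = 𝔼[ 𝔼[ξ | 𝒢²] | 𝒢¹ ]. (This is the commutation identity underlying the paper's definition ξ̂̌(t) := 𝔼[𝔼[ξ(t)|𝒢¹_t]|𝒢²_t] ≡ 𝔼[𝔼[ξ(t)|𝒢²_t]|𝒢¹_t].) -/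
open MeasureTheory ProbabilityTheory Set

section

variable {Ω E : Type*} [NormedAddCommGroup E] [NormedSpace ℝ E] [CompleteSpace E]
  {m₁ m₂ m' m : MeasurableSpace Ω} {μ : Measure Ω} {f : Ω → E}

theorem isPiSystem_image2_inter (m₁ m₂ : MeasurableSpace Ω) :
    IsPiSystem (image2 (· ∩ ·) {s | MeasurableSet[m₁] s} {t | MeasurableSet[m₂] t}) := by
  rintro _ ⟨s, hs, t, ht, rfl⟩ _ ⟨s', hs', t', ht', rfl⟩ -
  exact ⟨s ∩ s', hs.inter hs', t ∩ t', ht.inter ht', inter_inter_inter_comm s s' t t'⟩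

theorem sup_eq_generateFrom_image2_inter (m₁ m₂ : MeasurableSpace Ω) :
    m₁ ⊔ m₂ = MeasurableSpace.generateFrom
      (image2 (· ∩ ·) {s | MeasurableSet[m₁] s} {t | MeasurableSet[m₂] t}) := by
  refine le_antisymm (sup_le (fun s hs ↦ ?_) (fun t ht ↦ ?_))
    (MeasurableSpace.generateFrom_le ?_)
  · exact .basic _ ⟨s, hs, univ, MeasurableSet.univ, inter_univ s⟩
  · exact .basic _ ⟨univ, MeasurableSet.univ, t, ht, univ_inter t⟩
  · rintro _ ⟨s, hs, t, ht, rfl⟩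
    exact MeasurableSet.inter (le_sup_left (a := m₁) (b := m₂) s hs)
      (le_sup_right (a := m₁) (b := m₂) t ht)

/-- If `f` is `m₁`-measurable and `m₁` is independent of `m₂`, then the integral of `f` over the
intersection of an `m₁`-measurable set with an `m₂`-measurable set factorizes. -/
theorem setIntegral_inter_of_indep [IsFiniteMeasure μ] (hm₁ : m₁ ≤ m) (hm₂ : m₂ ≤ m)
    (hindep : Indep m₁ m₂ μ) (hf : StronglyMeasurable[m₁] f) (hfint : Integrable f μ)
    {s t : Set Ω} (hs : MeasurableSet[m₂] s) (ht : MeasurableSet[m₁] t) :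
    ∫ x in s ∩ t, f x ∂μ = μ.real s • ∫ x in t, f x ∂μ := by
  have hcond : μ[t.indicator f | m₂] =ᵐ[μ] fun _ ↦ ∫ x, t.indicator f x ∂μ :=
    condExp_indep_eq hm₁ hm₂ (hf.indicator ht) hindep
  rw [← setIntegral_indicator (hm₁ t ht),
    ← setIntegral_condExp hm₂ (hfint.indicator (hm₁ t ht)) hs,
    integral_congr_ae (ae_restrict_of_ae hcond), setIntegral_const,
    integral_indicator (hm₁ t ht)]

/-- Enlarging the conditioning σ-algebra `m' ≤ m₁` by a σ-algebra `m₂` independent of `m₁` does not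
change the conditional expectation of an `m₁`-measurable function. -/
theorem condExp_sup_of_indep [IsFiniteMeasure μ] (hm₁ : m₁ ≤ m) (hm₂ : m₂ ≤ m) (hm' : m' ≤ m₁)
    (hindep : Indep m₁ m₂ μ) (hf : StronglyMeasurable[m₁] f) (hfint : Integrable f μ) :
    μ[f | m₂ ⊔ m'] =ᵐ[μ] μ[f | m'] := by
  have hle : m₂ ⊔ m' ≤ m := sup_le hm₂ (hm'.trans hm₁)
  have hint : Integrable (μ[f | m']) μ := integrable_condExp
  refine (ae_eq_condExp_of_forall_setIntegral_eq hle hfint (fun _ _ _ ↦ hint.integrableOn)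
    ?_ (stronglyMeasurable_condExp.mono
      (le_sup_right : m' ≤ m₂ ⊔ m')).aestronglyMeasurable).symm
  intro u hu _
  induction u, hu using MeasurableSpace.induction_on_inter
    (sup_eq_generateFrom_image2_inter m₂ m') (isPiSystem_image2_inter m₂ m') with
  | empty => simp
  | basic u hu =>
    obtain ⟨s, hs, t, ht, rfl⟩ := hu
    rw [setIntegral_inter_of_indep hm₁ hm₂ hindep (stronglyMeasurable_condExp.mono hm') hint hs
        (hm' t ht), setIntegral_inter_of_indep hm₁ hm₂ hindep hf hfint hs (hm' t ht),
      setIntegral_condExp (hm'.trans hm₁) hfint ht]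
  | compl u hu ih =>
    rw [setIntegral_compl (hle u hu) hint, setIntegral_compl (hle u hu) hfint,
      ih (measure_lt_top μ u), integral_condExp (hm'.trans hm₁)]
  | iUnion u hdisj hu ih =>
    rw [integral_iUnion (fun i ↦ hle _ (hu i)) hdisj hint.integrableOn,
      integral_iUnion (fun i ↦ hle _ (hu i)) hdisj hfint.integrableOn]
    exact tsum_congr fun i ↦ ih i (measure_lt_top μ _)

/-- If `m₁` and `m₂` are σ-algebras with `m' ≤ m₁` and `m₂` independent of `m₁`, conditioning on
`m₁` and then on `m₂ ⊔ m'` amounts to conditioning on `m'`. -/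
theorem condExp_condExp_sup_of_indep [IsFiniteMeasure μ] (hm₁ : m₁ ≤ m) (hm₂ : m₂ ≤ m)
    (hm' : m' ≤ m₁) (hindep : Indep m₁ m₂ μ) :
    μ[μ[f | m₁] | m₂ ⊔ m'] =ᵐ[μ] μ[f | m'] :=
  (condExp_sup_of_indep hm₁ hm₂ hm' hindep stronglyMeasurable_condExp integrable_condExp).trans
    (condExp_condExp_of_le hm' hm₁)

end

/-- With `𝒜, ℬ, 𝒞` mutually independent and `𝒢¹ := 𝒜 ⊔ 𝒞`, `𝒢² := ℬ ⊔ 𝒞`,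
the iterated conditional expectations commute:
`𝔼[𝔼[ξ | 𝒢¹] | 𝒢²] = 𝔼[𝔼[ξ | 𝒢²] | 𝒢¹]` a.s. -/
theorem iterated_condexp_comm
    {Ω : Type*} (𝒜 ℬ 𝒞 : MeasurableSpace Ω) [mΩ : MeasurableSpace Ω]
    {μ : Measure Ω} [IsProbabilityMeasure μ]
    (h𝒜 : 𝒜 ≤ mΩ) (hℬ : ℬ ≤ mΩ) (h𝒞 : 𝒞 ≤ mΩ)
    (hindep : ProbabilityTheory.iIndep ![𝒜, ℬ, 𝒞] μ)
    (ξ : Ω → ℝ) (hξ : Integrable ξ μ) :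
    μ[μ[ξ | 𝒜 ⊔ 𝒞] | ℬ ⊔ 𝒞] =ᵐ[μ] μ[μ[ξ | ℬ ⊔ 𝒞] | 𝒜 ⊔ 𝒞] := by
  have hle : ∀ i, ![𝒜, ℬ, 𝒞] i ≤ mΩ := by
    intro i
    fin_cases i <;> assumption
  have h𝒜𝒞 : Indep (𝒜 ⊔ 𝒞) ℬ μ := by
    simpa [iSup_or, iSup_sup_eq] using
      indep_iSup_of_disjoint hle hindep (S := {0, 2}) (T := {1}) (by simp)
  have hℬ𝒞 : Indep (ℬ ⊔ 𝒞) 𝒜 μ := by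
    simpa [iSup_or, iSup_sup_eq] using
      indep_iSup_of_disjoint hle hindep (S := {1, 2}) (T := {0}) (by simp)
  exact (condExp_condExp_sup_of_indep (sup_le h𝒜 h𝒞) hℬ le_sup_right h𝒜𝒞).trans
    (condExp_condExp_sup_of_indep (sup_le hℬ h𝒞) h𝒜 le_sup_right hℬ𝒞).symm
end

section
/- Let 𝒜, ℬ, 𝒞 be mutually independent sub-σ-algebras of ℱ, and set 𝒢¹ := 𝒜 ⊔ 𝒞 and 𝒢² := ℬ ⊔ 𝒞. Let X : Ω → ℝ^m be integrable, write X̂ := 𝔼[X|𝒢¹], X̌ := 𝔼[X|𝒢²], X̄ := 𝔼[X|𝒞], and let 𝒫₁, 𝒫₂, 𝒫₃, 𝒫₄ be (deterministic) m×m real matrices. Define Y := 𝒫₁X + 𝒫₂X̂ + 𝒫₃X̌ + 𝒫₄X̄. Then μ-almost surely 𝔼[Y | 𝒢¹] = (𝒫₁+𝒫₂)X̂ + (𝒫₃+𝒫₄)X̄ and 𝔼[Y | 𝒢²] = (𝒫₁+𝒫₃)X̌ + (𝒫₂+𝒫₄)X̄. (This is the projection step by which the ansatz Y(t) = 𝒫₁X(t)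 + 𝒫₂X̂(t) + 𝒫₃X̌(t) + 𝒫₄X̂̌(t) yields the state-estimate feedback representation of the Stackelberg equilibrium strategies.) -/
open MeasureTheory

open scoped Matrix

namespace MeasureTheory

section CondExpSup

variable {Ω E : Type*} [NormedAddCommGroup E] [NormedSpace ℝ E]
  {m₁ m₂ m₃ m : MeasurableSpace Ω} {μ : Measure Ω} {f : Ω → E}

theorem setIntegral_eq_of_forall_inter {g : Ω → E}
    (hm₁ : m₁ ≤ m) (hm₃ : m₃ ≤ m) (hf : Integrable f μ) (hg : Integrable g μ)
    (h : ∀ s t, MeasurableSet[m₁] s → MeasurableSet[m₃] t →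
      ∫ x in s ∩ t, f x ∂μ = ∫ x in s ∩ t, g x ∂μ)
    {u : Set Ω} (hu : MeasurableSet[m₁ ⊔ m₃] u) :
    ∫ x in u, f x ∂μ = ∫ x in u, g x ∂μ := by
  have hle : m₁ ⊔ m₃ ≤ m := sup_le hm₁ hm₃
  have huniv : ∫ x, f x ∂μ = ∫ x, g x ∂μ := by
    simpa using h Set.univ Set.univ MeasurableSet.univ MeasurableSet.univ
  let S : Set (Set Ω) :=
    {u | ∃ s t, MeasurableSet[m₁] s ∧ MeasurableSet[m₃] t ∧ u = s ∩ t}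
  have hgen : m₁ ⊔ m₃ = MeasurableSpace.generateFrom S := by
    refine le_antisymm (sup_le ?_ ?_) (MeasurableSpace.generateFrom_le ?_)
    · exact fun s hs => MeasurableSpace.measurableSet_generateFrom
        ⟨s, Set.univ, hs, MeasurableSet.univ, (Set.inter_univ s).symm⟩
    · exact fun t ht => MeasurableSpace.measurableSet_generateFrom
        ⟨Set.univ, t, MeasurableSet.univ, ht, (Set.univ_inter t).symm⟩
    · rintro _ ⟨s, t, hs, ht, rfl⟩
      exact MeasurableSet.inter ((le_sup_left : m₁ ≤ m₁ ⊔ m₃) s hs)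
        ((le_sup_right : m₃ ≤ m₁ ⊔ m₃) t ht)
  have hpi : IsPiSystem S := by
    rintro _ ⟨s, t, hs, ht, rfl⟩ _ ⟨s', t', hs', ht', rfl⟩ _
    exact ⟨s ∩ s', t ∩ t', hs.inter hs', ht.inter ht', Set.inter_inter_inter_comm _ _ _ _⟩
  induction u, hu using MeasurableSpace.induction_on_inter hgen hpi with
  | empty => simp
  | basic u hu =>
    obtain ⟨s, t, hs, ht, rfl⟩ := hu
    exact h s t hs ht
  | compl u hu ih =>
    rw [setIntegral_compl (hle u hu) hf, setIntegral_compl (hle u hu) hg, ih, huniv]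
  | iUnion u hd hu ih =>
    rw [integral_iUnion (fun i => hle _ (hu i)) hd hf.integrableOn,
      integral_iUnion (fun i => hle _ (hu i)) hd hg.integrableOn]
    exact tsum_congr ih

variable [CompleteSpace E]

theorem setIntegral_of_indep [IsFiniteMeasure μ] (hm₁ : m₁ ≤ m) (hm₂ : m₂ ≤ m)
    (hindep : ProbabilityTheory.Indep m₁ m₂ μ) (hf : StronglyMeasurable[m₂] f)
    (hfi : Integrable f μ) {s : Set Ω} (hs : MeasurableSet[m₁] s) :
    ∫ x in s, f x ∂μ = μ.real s • ∫ x, f x ∂μ := by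
  rw [← setIntegral_condExp hm₁ hfi hs,
    integral_congr_ae (ae_restrict_of_ae (condExp_indep_eq hm₂ hm₁ hf hindep.symm)),
    setIntegral_const]

/-- If `m₁` is independent of `m₂ ≥ m₃` and `f` is `m₂`-measurable, then adjoining `m₁` to `m₃`
does not change the conditional expectation of `f`. -/
theorem condExp_sup_of_indep [IsFiniteMeasure μ] (hm₁ : m₁ ≤ m) (hm₂ : m₂ ≤ m) (hm₃₂ : m₃ ≤ m₂)
    (hindep : ProbabilityTheory.Indep m₁ m₂ μ) (hf : StronglyMeasurable[m₂] f)
    (hfi : Integrable f μ) : μ[f | m₁ ⊔ m₃] =ᵐ[μ] μ[f | m₃] := by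
  have hm₃ : m₃ ≤ m := hm₃₂.trans hm₂
  have hmeas : StronglyMeasurable[m₁ ⊔ m₃] (μ[f | m₃]) :=
    stronglyMeasurable_condExp.mono le_sup_right
  refine (ae_eq_condExp_of_forall_setIntegral_eq (sup_le hm₁ hm₃) hfi
    (fun s _ _ => integrable_condExp.integrableOn) (fun u hu _ => ?_)
    hmeas.aestronglyMeasurable).symm
  refine setIntegral_eq_of_forall_inter hm₁ hm₃ integrable_condExp hfi (fun s t hs ht => ?_) hu
  have key : ∀ g : Ω → E, StronglyMeasurable[m₂] g → Integrable g μ →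
      ∫ x in s ∩ t, g x ∂μ = μ.real s • ∫ x in t, g x ∂μ := fun g hg hgi => by
    rw [← setIntegral_indicator (hm₃ t ht), ← integral_indicator (hm₃ t ht)]
    exact setIntegral_of_indep hm₁ hm₂ hindep (hg.indicator (hm₃₂ t ht))
      (hgi.indicator (hm₃ t ht)) hs
  rw [key _ (stronglyMeasurable_condExp.mono hm₃₂) integrable_condExp, key f hf hfi,
    setIntegral_condExp hm₃ hfi ht]

end CondExpSup

section MulVec

variable {Ω : Type*} {m₀ m : MeasurableSpace Ω} {μ : Measure Ω} {k l : ℕ} {X : Ω → Fin l → ℝ}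

theorem Integrable.matrix_mulVec (hX : Integrable X μ) (P : Matrix (Fin k) (Fin l) ℝ) :
    Integrable (fun ω => P *ᵥ X ω) μ :=
  (LinearMap.toContinuousLinearMap P.mulVecLin).integrable_comp hX

theorem condExp_matrix_mulVec (hX : Integrable X μ) (P : Matrix (Fin k) (Fin l) ℝ) :
    μ[fun ω => P *ᵥ X ω | m₀] =ᵐ[μ] fun ω => P *ᵥ (μ[X | m₀]) ω :=
  ((LinearMap.toContinuousLinearMap P.mulVecLin).comp_condExp_comm hX).symm

end MulVec

theorem condExp_sup_matrix_combination {Ω : Type*} {m₁ m₂ m₃ m : MeasurableSpace Ω}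
    {μ : Measure Ω} [IsFiniteMeasure μ] (hm₁ : m₁ ≤ m) (hm₂ : m₂ ≤ m) (hm₃ : m₃ ≤ m)
    (hindep : ProbabilityTheory.Indep m₁ (m₂ ⊔ m₃) μ) {k l : ℕ} {X : Ω → Fin l → ℝ}
    (hX : Integrable X μ) (P₁ P₂ P₃ P₄ : Matrix (Fin k) (Fin l) ℝ) :
    μ[fun ω => P₁ *ᵥ X ω + P₂ *ᵥ (μ[X | m₁ ⊔ m₃]) ω + P₃ *ᵥ (μ[X | m₂ ⊔ m₃]) ω
        + P₄ *ᵥ (μ[X | m₃]) ω | m₁ ⊔ m₃] =ᵐ[μ]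
      fun ω => (P₁ + P₂) *ᵥ (μ[X | m₁ ⊔ m₃]) ω + (P₃ + P₄) *ᵥ (μ[X | m₃]) ω := by
  have hle₁ : m₁ ⊔ m₃ ≤ m := sup_le hm₁ hm₃
  have hle₂ : m₂ ⊔ m₃ ≤ m := sup_le hm₂ hm₃
  have i₁ := hX.matrix_mulVec P₁
  have i₂ := (integrable_condExp (μ := μ) (m := m₁ ⊔ m₃) (f := X)).matrix_mulVec P₂
  have i₃ := (integrable_condExp (μ := μ) (m := m₂ ⊔ m₃) (f := X)).matrix_mulVec P₃
  have i₄ := (integrable_condExp (μ := μ) (m := m₃) (f := X)).matrix_mulVec P₄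
  have h₂ : μ[μ[X | m₁ ⊔ m₃] | m₁ ⊔ m₃] = μ[X | m₁ ⊔ m₃] :=
    condExp_of_stronglyMeasurable hle₁ stronglyMeasurable_condExp integrable_condExp
  have h₃ : μ[μ[X | m₂ ⊔ m₃] | m₁ ⊔ m₃] =ᵐ[μ] μ[X | m₃] :=
    (condExp_sup_of_indep hm₁ hle₂ le_sup_right hindep stronglyMeasurable_condExp
      integrable_condExp).trans (condExp_condExp_of_le le_sup_right hle₂)
  have h₄ : μ[μ[X | m₃] | m₁ ⊔ m₃] = μ[X | m₃] :=
    condExp_of_stronglyMeasurable hle₁ (stronglyMeasurable_condExp.mono le_sup_right)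
      integrable_condExp
  filter_upwards [condExp_add ((i₁.add i₂).add i₃) i₄ (m₁ ⊔ m₃),
    condExp_add (i₁.add i₂) i₃ (m₁ ⊔ m₃), condExp_add i₁ i₂ (m₁ ⊔ m₃),
    condExp_matrix_mulVec (m₀ := m₁ ⊔ m₃) hX P₁,
    condExp_matrix_mulVec (m₀ := m₁ ⊔ m₃)
      (integrable_condExp (μ := μ) (m := m₁ ⊔ m₃) (f := X)) P₂,
    condExp_matrix_mulVec (m₀ := m₁ ⊔ m₃)
      (integrable_condExp (μ := μ) (m := m₂ ⊔ m₃) (f := X)) P₃,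
    condExp_matrix_mulVec (m₀ := m₁ ⊔ m₃)
      (integrable_condExp (μ := μ) (m := m₃) (f := X)) P₄, h₃]
    with ω a₁ a₂ a₃ e₁ e₂ e₃ e₄ e₅
  refine a₁.trans ?_
  rw [Pi.add_apply, a₂, Pi.add_apply, a₃, Pi.add_apply, e₁, e₂, e₃, e₄, e₅, h₂, h₄,
    Matrix.add_mulVec, Matrix.add_mulVec]
  abel

end MeasureTheory

/-- Projection step: for `Y = 𝒫₁X + 𝒫₂X̂ + 𝒫₃X̌ + 𝒫₄X̄` with
`X̂ = 𝔼[X|𝒜⊔𝒞]`, `X̌ = 𝔼[X|ℬ⊔𝒞]`, `X̄ = 𝔼[X|𝒞]` and `𝒜, ℬ, 𝒞` mutually independent,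
one has `𝔼[Y|𝒜⊔𝒞] = (𝒫₁+𝒫₂)X̂ + (𝒫₃+𝒫₄)X̄` and `𝔼[Y|ℬ⊔𝒞] = (𝒫₁+𝒫₃)X̌ + (𝒫₂+𝒫₄)X̄`. -/
theorem condexp_matrix_ansatz_projection
    {Ω : Type*} (𝒜 ℬ 𝒞 : MeasurableSpace Ω) [mΩ : MeasurableSpace Ω]
    {μ : Measure Ω} [IsProbabilityMeasure μ]
    (h𝒜 : 𝒜 ≤ mΩ) (hℬ : ℬ ≤ mΩ) (h𝒞 : 𝒞 ≤ mΩ)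
    (hindep : ProbabilityTheory.iIndep ![𝒜, ℬ, 𝒞] μ)
    (m : ℕ) (X : Ω → (Fin m → ℝ)) (hX : Integrable X μ)
    (𝒫₁ 𝒫₂ 𝒫₃ 𝒫₄ : Matrix (Fin m) (Fin m) ℝ)
    (Y : Ω → (Fin m → ℝ))
    (hY : Y = fun ω => 𝒫₁.mulVec (X ω) + 𝒫₂.mulVec ((μ[X | 𝒜 ⊔ 𝒞]) ω)
      + 𝒫₃.mulVec ((μ[X | ℬ ⊔ 𝒞]) ω) + 𝒫₄.mulVec ((μ[X | 𝒞]) ω)) :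
    (μ[Y | 𝒜 ⊔ 𝒞] =ᵐ[μ] fun ω =>
        (𝒫₁ + 𝒫₂).mulVec ((μ[X | 𝒜 ⊔ 𝒞]) ω) + (𝒫₃ + 𝒫₄).mulVec ((μ[X | 𝒞]) ω)) ∧
    (μ[Y | ℬ ⊔ 𝒞] =ᵐ[μ] fun ω =>
        (𝒫₁ + 𝒫₃).mulVec ((μ[X | ℬ ⊔ 𝒞]) ω) + (𝒫₂ + 𝒫₄).mulVec ((μ[X | 𝒞]) ω)) := by
  have hle : ∀ i, ![𝒜, ℬ, 𝒞] i ≤ mΩ := by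
    intro i
    fin_cases i <;> assumption
  have h₁ : ProbabilityTheory.Indep 𝒜 (ℬ ⊔ 𝒞) μ := by
    have := ProbabilityTheory.indep_iSup_of_disjoint hle hindep
      (S := {0}) (T := {1, 2}) (by simp)
    simpa [iSup_insert] using this
  have h₂ : ProbabilityTheory.Indep ℬ (𝒜 ⊔ 𝒞) μ := by
    have := ProbabilityTheory.indep_iSup_of_disjoint hle hindep
      (S := {1}) (T := {0, 2}) (by simp)
    simpa [iSup_insert] using this
  subst hY
  refine ⟨condExp_sup_matrix_combination h𝒜 hℬ h𝒞 h₁ hX 𝒫₁ 𝒫₂ 𝒫₃ 𝒫₄, ?_⟩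
  have h := condExp_sup_matrix_combination hℬ h𝒜 h𝒞 h₂ hX 𝒫₁ 𝒫₃ 𝒫₂ 𝒫₄
  simpa only [add_right_comm] using h
end

section
/- Let U and H be real Hilbert spaces, L : U → H a continuous linear map, b ∈ H, and let Q : H → H and N : U → U be continuous self-adjoint linear operators such that ⟨Qh, h⟩ ≥ 0 for all h ∈ H and there is δ > 0 with ⟨Nv, v⟩ ≥ δ‖v‖² for all v ∈ U. Define J(u) := ½⟨Q(b + Lu), b + Lu⟩ + ½⟨Nu, u⟩. Then: (i) an element u* ∈ U minimizes J over U if and only if N u* + L*(Q(b + L u*)) = 0, where L* is the Hilbert-space adjoint of L; and (ii) J has exactly one minimizer. (This abstracts the derivation in which setting the Gâteaux derivative of the quadratic cost functional to zero for all admissible perturbations characterizes the optimal control of each player.) -/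
open RealInnerProductSpace

/-- The quadratic cost functional `J(u) = ½⟨Q(b+Lu), b+Lu⟩ + ½⟨Nu, u⟩`. -/
noncomputable def quadraticCost {U H : Type*}
    [NormedAddCommGroup U] [InnerProductSpace ℝ U]
    [NormedAddCommGroup H] [InnerProductSpace ℝ H]
    (L : U →L[ℝ] H) (b : H) (Q : H →L[ℝ] H) (N : U →L[ℝ] U) (u : U) : ℝ :=
  (1 / 2 : ℝ) * ⟪Q (b + L u), b + L u⟫ + (1 / 2 : ℝ) * ⟪N u, u⟫

section

variable {U H : Type*}
  [NormedAddCommGroup U] [InnerProductSpace ℝ U] [CompleteSpace U]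
  [NormedAddCommGroup H] [InnerProductSpace ℝ H] [CompleteSpace H]

/-- Second-order expansion of the quadratic cost around `u`. -/
theorem quadraticCost_add (L : U →L[ℝ] H) (b : H) {Q : H →L[ℝ] H} {N : U →L[ℝ] U}
    (hQsa : ∀ v w : H, ⟪Q v, w⟫ = ⟪v, Q w⟫) (hNsa : ∀ v w : U, ⟪N v, w⟫ = ⟪v, N w⟫) (u v : U) :
    quadraticCost L b Q N (u + v) = quadraticCost L b Q N u
      + ⟪N u + ContinuousLinearMap.adjoint L (Q (b + L u)), v⟫
      + (1 / 2 : ℝ) * (⟪Q (L v), L v⟫ + ⟪N v, v⟫) := by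
  have hQ : ⟪Q (L v), b + L u⟫ = ⟪Q (b + L u), L v⟫ := by rw [hQsa, real_inner_comm]
  have hN : ⟪N v, u⟫ = ⟪N u, v⟫ := by rw [hNsa, real_inner_comm]
  have hL : b + L (u + v) = (b + L u) + L v := by rw [map_add, add_assoc]
  rw [quadraticCost, quadraticCost, hL]
  generalize b + L u = h at *
  simp only [map_add, inner_add_left, inner_add_right, ContinuousLinearMap.adjoint_inner_left,
    hQ, hN]
  ring

/-- A point minimizes the quadratic cost iff the gradient vanishes there. -/
theorem quadraticCost_minimizer_iff (L : U →L[ℝ] H) (b : H) {Q : H →L[ℝ] H} {N : U →L[ℝ] U}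
    (hQsa : ∀ v w : H, ⟪Q v, w⟫ = ⟪v, Q w⟫) (hNsa : ∀ v w : U, ⟪N v, w⟫ = ⟪v, N w⟫)
    (hQpos : ∀ h : H, 0 ≤ ⟪Q h, h⟫) (hNpos : ∀ v : U, 0 ≤ ⟪N v, v⟫) (u₀ : U) :
    (∀ u : U, quadraticCost L b Q N u₀ ≤ quadraticCost L b Q N u) ↔
      N u₀ + ContinuousLinearMap.adjoint L (Q (b + L u₀)) = 0 := by
  constructor
  · intro h
    set g := N u₀ + ContinuousLinearMap.adjoint L (Q (b + L u₀)) with hg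
    have key : ∀ t : ℝ,
        0 ≤ (1 / 2 : ℝ) * (⟪Q (L g), L g⟫ + ⟪N g, g⟫) * (t * t) + ⟪g, g⟫ * t + 0 := by
      intro t
      have ht := h (u₀ + t • g)
      rw [quadraticCost_add L b hQsa hNsa, ← hg] at ht
      simp only [map_smul, real_inner_smul_left, real_inner_smul_right] at ht
      linarith
    have hd := discrim_le_zero key
    rw [discrim, mul_zero, sub_zero] at hd
    exact inner_self_eq_zero.mp (pow_eq_zero_iff two_ne_zero |>.mp (le_antisymm hd (sq_nonneg _)))
  · intro h u
    have hu := quadraticCost_add L b hQsa hNsa u₀ (u - u₀)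
    rw [add_sub_cancel, h, inner_zero_left] at hu
    linarith [hQpos (L (u - u₀)), hNpos (u - u₀)]

/-- A coercive continuous linear operator on a real Hilbert space is bijective. -/
theorem ContinuousLinearMap.bijective_of_coercive (A : U →L[ℝ] U) {δ : ℝ} (hδ : 0 < δ)
    (hA : ∀ v : U, δ * ‖v‖ ^ 2 ≤ ⟪A v, v⟫) : Function.Bijective A := by
  have hB : IsCoercive ((innerSL ℝ).comp A : U →L[ℝ] U →L[ℝ] ℝ) := by
    refine ⟨δ, hδ, fun v => ?_⟩
    simpa [pow_two, mul_assoc] using hA v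
  have hAB : ∀ v, hB.continuousLinearEquivOfBilin v = A v := fun v =>
    ext_inner_right ℝ fun w => by simp [hB.continuousLinearEquivOfBilin_apply]
  rw [← funext hAB]
  exact hB.continuousLinearEquivOfBilin.bijective

end

/-- First-order characterization and unique existence of the minimizer of the
quadratic cost functional: `u*` minimizes `J` iff `Nu* + L*(Q(b+Lu*)) = 0`, and
`J` has exactly one minimizer. -/
theorem quadratic_cost_minimizer
    {U H : Type*}
    [NormedAddCommGroup U] [InnerProductSpace ℝ U] [CompleteSpace U]
    [NormedAddCommGroup H] [InnerProductSpace ℝ H] [CompleteSpace H]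
    (L : U →L[ℝ] H) (b : H) (Q : H →L[ℝ] H) (N : U →L[ℝ] U)
    (hQsa : ∀ v w : H, ⟪Q v, w⟫ = ⟪v, Q w⟫)
    (hNsa : ∀ v w : U, ⟪N v, w⟫ = ⟪v, N w⟫)
    (hQpos : ∀ h : H, 0 ≤ ⟪Q h, h⟫)
    (δ : ℝ) (hδ : 0 < δ) (hNcoer : ∀ v : U, δ * ‖v‖ ^ 2 ≤ ⟪N v, v⟫) :
    (∀ ustar : U,
      (∀ u : U, quadraticCost L b Q N ustar ≤ quadraticCost L b Q N u) ↔
        N ustar + (ContinuousLinearMap.adjoint L) (Q (b + L ustar)) = 0) ∧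
    (∃! u₀ : U, ∀ u : U, quadraticCost L b Q N u₀ ≤ quadraticCost L b Q N u) := by
  have hNpos : ∀ v : U, 0 ≤ ⟪N v, v⟫ := fun v => le_trans (by positivity) (hNcoer v)
  have hiff := quadraticCost_minimizer_iff L b hQsa hNsa hQpos hNpos
  refine ⟨hiff, ?_⟩
  have hbij : Function.Bijective (N + (ContinuousLinearMap.adjoint L).comp (Q.comp L)) := by
    refine ContinuousLinearMap.bijective_of_coercive _ hδ fun v => ?_
    simp only [add_apply, ContinuousLinearMap.comp_apply, inner_add_left,
      ContinuousLinearMap.adjoint_inner_left]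
    linarith [hNcoer v, hQpos (L v)]
  refine (existsUnique_congr fun u => ?_).mpr
    (hbij.existsUnique (-(ContinuousLinearMap.adjoint L (Q b))))
  rw [hiff, eq_neg_iff_add_eq_zero]
  simp only [add_apply, ContinuousLinearMap.comp_apply, map_add]
  rw [add_assoc, add_comm (ContinuousLinearMap.adjoint L (Q b))]
end

section
/- Let T > 0 and n, k ∈ ℕ. Let A₀, A₁, A₂, A₃ : [0,T] → ℝ^{n×n} and B₀, B₁, B₂, B₃ : [0,T] → ℝ^{n×k} be continuous matrix-valued functions, let Q₁ : [0,T] → ℝ^{n×n} be continuous with Q₁(t) symmetric positive semidefinite for every t, let N₁ : [0,T] → ℝ^{k×k} be continuous with N₁(t) symmetric and N₁(t) ≥ δ I_k for some δ > 0 and all t, and let G₁ ∈ ℝ^{n×n} be symmetric positive semidefinite. Then there exists a unique continuously differentiable P₁ : [0,T] → ℝ^{n×n} with P₁(t) symmetric positive semidefinite for all t, P₁(T) = G₁, and Ṗ₁ + P₁A₀ + A₀ᵀP₁ + Σᵢ₌₁³ AᵢᵀP₁Aᵢ + Q₁ − (P₁B₀ + Σᵢ₌₁³ AᵢᵀP₁Bᵢ)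 N̄₁⁻¹ (B₀ᵀP₁ + Σᵢ₌₁³ BᵢᵀP₁Aᵢ) = 0 on [0,T], where N̄₁(t) := N₁(t) + Σᵢ₌₁³ Bᵢ(t)ᵀP₁(t)Bᵢ(t); here N̄₁(t) is positive definite (hence invertible) for all t, so the equation is well posed. (This is the solvability of the follower's Riccati equation (2.17), cited from Theorem 7.10, Chapter 6 of Yong–Zhou.) -/
open Matrix

/-- `N̄₁(t) = N₁(t) + Σᵢ₌₁³ Bᵢ(t)ᵀ P(t) Bᵢ(t)`. -/
noncomputable def riccatiNbar {n k : ℕ}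
    (N₁ : ℝ → Matrix (Fin k) (Fin k) ℝ)
    (B₁ B₂ B₃ : ℝ → Matrix (Fin n) (Fin k) ℝ)
    (P : ℝ → Matrix (Fin n) (Fin n) ℝ) (t : ℝ) : Matrix (Fin k) (Fin k) ℝ :=
  N₁ t + (B₁ t)ᵀ * P t * B₁ t + (B₂ t)ᵀ * P t * B₂ t + (B₃ t)ᵀ * P t * B₃ t

/-- The right-hand side `Ṗ₁ = −[P₁A₀ + A₀ᵀP₁ + Σᵢ AᵢᵀP₁Aᵢ + Q₁
  − (P₁B₀ + Σᵢ AᵢᵀP₁Bᵢ) N̄₁⁻¹ (B₀ᵀP₁ + Σᵢ BᵢᵀP₁Aᵢ)]` of the follower's Riccati equation. -/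
noncomputable def riccatiRHS {n k : ℕ}
    (A₀ A₁ A₂ A₃ : ℝ → Matrix (Fin n) (Fin n) ℝ)
    (B₀ B₁ B₂ B₃ : ℝ → Matrix (Fin n) (Fin k) ℝ)
    (Q₁ : ℝ → Matrix (Fin n) (Fin n) ℝ)
    (N₁ : ℝ → Matrix (Fin k) (Fin k) ℝ)
    (P : ℝ → Matrix (Fin n) (Fin n) ℝ) (t : ℝ) : Matrix (Fin n) (Fin n) ℝ :=
  -(P t * A₀ t + (A₀ t)ᵀ * P t + (A₁ t)ᵀ * P t * A₁ t + (A₂ t)ᵀ * P t * A₂ t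
    + (A₃ t)ᵀ * P t * A₃ t + Q₁ t
    - (P t * B₀ t + (A₁ t)ᵀ * P t * B₁ t + (A₂ t)ᵀ * P t * B₂ t + (A₃ t)ᵀ * P t * B₃ t)
      * (riccatiNbar N₁ B₁ B₂ B₃ P t)⁻¹
      * ((B₀ t)ᵀ * P t + (B₁ t)ᵀ * P t * A₁ t + (B₂ t)ᵀ * P t * A₂ t
        + (B₃ t)ᵀ * P t * A₃ t))

/-- `P₁` is a well-posed solution of the follower's Riccati equation (2.17) on `[0,T]`:
`P₁(t)` is symmetric positive semidefinite, `P₁(T) = G₁`, `N̄₁(t)` is positive definite,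
and the (entrywise) differential equation holds on `[0,T]`. -/
def IsRiccatiSolution {n k : ℕ} (T : ℝ)
    (A₀ A₁ A₂ A₃ : ℝ → Matrix (Fin n) (Fin n) ℝ)
    (B₀ B₁ B₂ B₃ : ℝ → Matrix (Fin n) (Fin k) ℝ)
    (Q₁ : ℝ → Matrix (Fin n) (Fin n) ℝ)
    (N₁ : ℝ → Matrix (Fin k) (Fin k) ℝ)
    (G₁ : Matrix (Fin n) (Fin n) ℝ)
    (P : ℝ → Matrix (Fin n) (Fin n) ℝ) : Prop :=
  (∀ t ∈ Set.Icc (0 : ℝ) T, (P t).PosSemidef) ∧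
  P T = G₁ ∧
  (∀ t ∈ Set.Icc (0 : ℝ) T, (riccatiNbar N₁ B₁ B₂ B₃ P t).PosDef) ∧
  (∀ t ∈ Set.Icc (0 : ℝ) T, ∀ i j,
    HasDerivWithinAt (fun s => P s i j)
      (riccatiRHS A₀ A₁ A₂ A₃ B₀ B₁ B₂ B₃ Q₁ N₁ P t i j) (Set.Icc (0 : ℝ) T) t)

section Tangency

open Set Filter Topology Metric

/-- The metric projection onto a closed convex subset of a real Hilbert space is nonexpansive. -/
theorem exists_lipschitzWith_one_retraction {F : Type*} [NormedAddCommGroup F]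
    [InnerProductSpace ℝ F] [CompleteSpace F] {C : Set F} (hne : C.Nonempty) (hcl : IsClosed C)
    (hconv : Convex ℝ C) :
    ∃ p : F → F, LipschitzWith 1 p ∧ (∀ x, p x ∈ C) ∧ ∀ x ∈ C, p x = x := by
  choose p hpC hp using exists_norm_eq_iInf_of_complete_convex hne hcl.isComplete hconv
  have hinner : ∀ u, ∀ w ∈ C, inner ℝ (u - p u) (w - p u) ≤ 0 := fun u =>
    (norm_eq_iInf_iff_real_inner_le_zero hconv (hpC u)).1 (hp u)
  refine ⟨p, LipschitzWith.of_dist_le_mul fun u v => ?_, hpC, fun x hx => ?_⟩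
  · rw [dist_eq_norm, dist_eq_norm, NNReal.coe_one, one_mul]
    have h₁ := hinner u _ (hpC v)
    have h₂ := hinner v _ (hpC u)
    have h₃ : inner ℝ (u - p u) (p v - p u) + inner ℝ (v - p v) (p u - p v)
        = inner ℝ (p u - p v) (p u - p v) - inner ℝ (u - v) (p u - p v) := by
      simp only [inner_sub_left, inner_sub_right]
      ring
    rw [real_inner_self_eq_norm_sq] at h₃
    have h₄ := real_inner_le_norm (u - v) (p u - p v)
    by_contra! hlt
    nlinarith [norm_nonneg (u - v), norm_nonneg (p u - p v)]
  · have h := hinner x x hx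
    rw [real_inner_self_eq_norm_sq] at h
    have h0 : ‖x - p x‖ = 0 := by nlinarith [norm_nonneg (x - p x)]
    exact (sub_eq_zero.1 (norm_eq_zero.1 h0)).symm

/-- A nonempty closed convex subset of a finite-dimensional space is a Lipschitz retract. -/
theorem exists_lipschitzWith_retraction {E : Type*} [NormedAddCommGroup E] [NormedSpace ℝ E]
    [FiniteDimensional ℝ E] {C : Set E} (hne : C.Nonempty) (hcl : IsClosed C)
    (hconv : Convex ℝ C) :
    ∃ (p : E → E) (K : NNReal), LipschitzWith K p ∧ (∀ x, p x ∈ C) ∧ ∀ x ∈ C, p x = x := by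
  let e : E ≃L[ℝ] EuclideanSpace ℝ (Fin (Module.finrank ℝ E)) := toEuclidean
  obtain ⟨q, hq, hqC, hqfix⟩ := exists_lipschitzWith_one_retraction
    (C := e.symm ⁻¹' C) (hne.preimage e.symm.surjective) (hcl.preimage e.symm.continuous)
    (hconv.linear_preimage e.symm.toLinearMap)
  refine ⟨fun x => e.symm (q (e x)), _,
    (e.symm : _ →L[ℝ] E).lipschitz.comp (hq.comp (e : E →L[ℝ] _).lipschitz),
    fun x => hqC (e x), fun x hx => ?_⟩
  simp only [hqfix (e x) (by simpa using hx), e.symm_apply_apply]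

/-- Invariance of a compact set under a vector field which is subtangent to second order. -/
theorem mem_of_hasDerivWithinAt_of_tangent {E : Type*} [NormedAddCommGroup E] [NormedSpace ℝ E]
    {C : Set E} (hC : IsCompact C) {T K : ℝ} {f : ℝ → E → E} {α : ℝ → E}
    (hα : ∀ t ∈ Icc 0 T, HasDerivWithinAt α (f t (α t)) (Icc 0 T) t) (hα0 : α 0 ∈ C)
    (hlip : ∀ t ∈ Icc 0 T, ∀ x, ∀ y ∈ C, ‖f t x - f t y‖ ≤ K * ‖x - y‖)
    (htan : ∀ t ∈ Icc 0 T, ∀ x ∈ C, ∃ w : E, ∀ᶠ h in 𝓝[>] (0 : ℝ),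
      x + h • f t x + h ^ 2 • w ∈ C) :
    ∀ t ∈ Icc 0 T, α t ∈ C := by
  have hne : C.Nonempty := ⟨_, hα0⟩
  have hcont : ContinuousOn α (Icc 0 T) := fun t ht => (hα t ht).continuousWithinAt
  have hd := le_gronwallBound_of_liminf_deriv_right_le (f := fun t => infDist (α t) C)
    (f' := fun t => K * infDist (α t) C) (δ := 0) (K := K) (ε := 0) (a := 0) (b := T)
    ((continuous_infDist_pt C).comp_continuousOn hcont) ?_ (infDist_zero_of_mem hα0).le
    (fun t _ => by simp)
  · intro t ht
    have h := hd t ht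
    rw [gronwallBound_ε0_δ0] at h
    exact (hC.isClosed.mem_iff_infDist_zero hne).2 (le_antisymm h infDist_nonneg)
  · intro t ht r hr
    have htI := Ico_subset_Icc_self ht
    obtain ⟨p, hpC, hp⟩ := hC.exists_infDist_eq_dist hne (α t)
    obtain ⟨w, hw⟩ := htan t htI p hpC
    have hslope : Tendsto (slope α t) (𝓝[>] t) (𝓝 (f t (α t))) := by
      have hnhds : Icc 0 T ∈ 𝓝[≥] t :=
        mem_of_superset (Icc_mem_nhdsGE ht.2) (Icc_subset_Icc_left ht.1)
      have h := (hα t htI).mono_of_mem_nhdsWithin hnhds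
      exact hasDerivWithinAt_iff_tendsto_slope' self_notMem_Ioi |>.1 (h.mono Ioi_subset_Ici_self)
    have hshift : Tendsto (fun z => z - t) (𝓝[>] t) (𝓝[>] 0) := by
      refine tendsto_nhdsWithin_iff.2 ⟨?_, ?_⟩
      · have h : Tendsto (fun z => z - t) (𝓝 t) (𝓝 (t - t)) :=
          (continuous_id.sub continuous_const).tendsto t
        rw [sub_self] at h
        exact h.mono_left nhdsWithin_le_nhds
      · filter_upwards [self_mem_nhdsWithin] with z hz
        exact mem_Ioi.2 (sub_pos.2 (mem_Ioi.1 hz))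
    have hlim : Tendsto (fun z => K * infDist (α t) C + (z - t) * ‖w‖ +
        ‖slope α t z - f t (α t)‖) (𝓝[>] t) (𝓝 (K * infDist (α t) C + 0 * ‖w‖ + 0)) := by
      refine (tendsto_const_nhds.add
        ((hshift.mono_right nhdsWithin_le_nhds).mul_const _)).add ?_
      have h := (hslope.sub_const (f t (α t))).norm
      rwa [sub_self, norm_zero] at h
    rw [zero_mul, add_zero, add_zero] at hlim
    refine Eventually.frequently ?_
    filter_upwards [hlim.eventually_lt_const hr, hshift.eventually hw, self_mem_nhdsWithin]
      with z hz hzC (hzt : t < z)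
    refine lt_of_le_of_lt ?_ hz
    have hpos : 0 < z - t := sub_pos.2 hzt
    have hα_z : α z - α t = (z - t) • slope α t z := (sub_smul_slope α t z).symm
    have key : infDist (α z) C ≤ ‖α t - p‖ + (z - t) * (K * ‖α t - p‖)
        + (z - t) * ‖slope α t z - f t (α t)‖ + (z - t) ^ 2 * ‖w‖ := by
      refine (infDist_le_dist_of_mem hzC).trans ?_
      rw [dist_eq_norm]
      have hsplit : α z - (p + (z - t) • f t p + (z - t) ^ 2 • w)
          = (α t - p) + (z - t) • (f t (α t) - f t p)
            + (z - t) • (slope α t z - f t (α t)) - (z - t) ^ 2 • w := by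
        rw [smul_sub, smul_sub, ← hα_z]
        abel
      rw [hsplit]
      refine (norm_sub_le _ _).trans (add_le_add ((norm_add_le _ _).trans (add_le_add
        ((norm_add_le _ _).trans (add_le_add le_rfl ?_)) ?_)) ?_)
      · rw [norm_smul, Real.norm_of_nonneg hpos.le]
        exact mul_le_mul_of_nonneg_left (hlip t htI _ p hpC) hpos.le
      · rw [norm_smul, Real.norm_of_nonneg hpos.le]
      · rw [norm_smul, Real.norm_of_nonneg (by positivity)]
    rw [dist_eq_norm] at hp
    rw [← hp] at key
    rw [inv_mul_le_iff₀ hpos]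
    linarith

/-- Global existence for a vector field which is Lipschitz on a compact convex set and subtangent
to it. -/
theorem exists_forall_hasDerivWithinAt_mem_of_tangent {E : Type*} [NormedAddCommGroup E]
    [NormedSpace ℝ E] [FiniteDimensional ℝ E] {C : Set E} (hC : IsCompact C)
    (hconv : Convex ℝ C) {x₀ : E} (hx₀ : x₀ ∈ C) {T : ℝ} (hT : 0 ≤ T) {f : ℝ → E → E}
    (hcont : ∀ x ∈ C, ContinuousOn (fun t => f t x) (Icc 0 T)) {L : NNReal}
    (hlip : ∀ t ∈ Icc 0 T, LipschitzOnWith L (f t) C)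
    (htan : ∀ t ∈ Icc 0 T, ∀ x ∈ C, ∃ w : E, ∀ᶠ h in 𝓝[>] (0 : ℝ),
      x + h • f t x + h ^ 2 • w ∈ C) :
    ∃ α : ℝ → E, α 0 = x₀ ∧ (∀ t ∈ Icc 0 T, α t ∈ C) ∧
      ∀ t ∈ Icc 0 T, HasDerivWithinAt α (f t (α t)) (Icc 0 T) t := by
  have : CompleteSpace E := FiniteDimensional.complete ℝ E
  obtain ⟨p, K, hp, hpC, hpfix⟩ := exists_lipschitzWith_retraction ⟨x₀, hx₀⟩ hC.isClosed hconv
  have hplip : ∀ t ∈ Icc 0 T, LipschitzWith (L * K) (fun x => f t (p x)) := fun t ht => by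
    have h := (hlip t ht).comp (hp.lipschitzOnWith (s := univ)) (fun x _ => hpC x)
    exact lipschitzOnWith_univ.1 h
  obtain ⟨D, hD⟩ := isCompact_Icc.exists_bound_of_continuousOn (hcont x₀ hx₀)
  obtain ⟨S, hS⟩ := hC.exists_bound_of_continuousOn (f := fun x => x - x₀) (by fun_prop)
  have hbound : ∀ t ∈ Icc 0 T, ∀ x ∈ C, ‖f t x‖ ≤ D + L * S := fun t ht x hx => by
    have h₁ := (hlip t ht).norm_sub_le hx hx₀
    have h₂ := mul_le_mul_of_nonneg_left (hS x hx) L.coe_nonneg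
    have h₃ := norm_le_norm_add_norm_sub' (f t x) (f t x₀)
    linarith [hD t ht]
  have hM : 0 ≤ D + L * S := (norm_nonneg _).trans (hbound 0 ⟨le_rfl, hT⟩ x₀ hx₀)
  have hPL : IsPicardLindelof (fun t x => f t (p x)) (tmin := 0) (tmax := T) ⟨0, le_rfl, hT⟩ x₀
      (⟨D + L * S, hM⟩ * ⟨T, hT⟩) 0 ⟨D + L * S, hM⟩ (L * K) :=
    { lipschitzOnWith := fun t ht => (hplip t ht).lipschitzOnWith
      continuousOn := fun x _ => hcont _ (hpC x)
      norm_le := fun t ht x _ => hbound t ht _ (hpC x)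
      mul_max_le := by
        change (D + L * S) * max (T - 0) (0 - 0) ≤ (D + L * S) * T - 0
        simp [hT] }
  obtain ⟨α, hα0, hα⟩ := hPL.exists_eq_forall_mem_Icc_hasDerivWithinAt₀
  have hmem := mem_of_hasDerivWithinAt_of_tangent hC (f := fun t x => f t (p x)) (K := L * K)
    hα (hα0 ▸ hx₀) (fun t ht x y _ => by simpa using (hplip t ht).norm_sub_le x y)
    (fun t ht x hx => by simpa only [hpfix x hx] using htan t ht x hx)
  exact ⟨α, hα0, hmem, fun t ht => by simpa only [hpfix _ (hmem t ht)] using hα t ht⟩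

end Tangency

section LoewnerOrder

open scoped Matrix.Norms.Frobenius

variable {n : ℕ}

theorem Matrix.abs_dotProduct_mulVec_le_frobenius (D : Matrix (Fin n) (Fin n) ℝ) (x : Fin n → ℝ) :
    |x ⬝ᵥ D *ᵥ x| ≤ ‖D‖ * (x ⬝ᵥ x) := by
  have hD : ‖D‖ ^ 2 = ∑ i, ∑ j, D i j ^ 2 := by
    rw [frobenius_norm_def, ← Real.sqrt_eq_rpow, Real.sq_sqrt (by positivity)]
    simp
  have hxx : 0 ≤ x ⬝ᵥ x := by
    simpa using dotProduct_star_self_nonneg x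
  refine abs_le_of_sq_le_sq ?_ (by positivity)
  have h := Finset.sum_mul_sq_le_sq_mul_sq (Finset.univ ×ˢ Finset.univ)
    (fun p : Fin n × Fin n => D p.1 p.2) (fun p => x p.1 * x p.2)
  simp only [Finset.sum_product] at h
  have h₁ : x ⬝ᵥ D *ᵥ x = ∑ i, ∑ j, D i j * (x i * x j) := by
    simp only [dotProduct, mulVec, Finset.mul_sum]
    exact Finset.sum_congr rfl fun i _ => Finset.sum_congr rfl fun j _ => by ring
  have h₂ : (x ⬝ᵥ x) ^ 2 = ∑ i, ∑ j, (x i * x j) ^ 2 := by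
    simp only [dotProduct, sq, Finset.sum_mul_sum]
    exact Finset.sum_congr rfl fun i _ => Finset.sum_congr rfl fun j _ => by ring
  rwa [mul_pow, hD, h₁, h₂]

theorem Matrix.IsHermitian.posSemidef_smul_one_sub {D : Matrix (Fin n) (Fin n) ℝ}
    (hD : D.IsHermitian) {a : ℝ} (ha : ‖D‖ ≤ a) :
    (a • (1 : Matrix (Fin n) (Fin n) ℝ) - D).PosSemidef := by
  refine .of_dotProduct_mulVec_nonneg ((isHermitian_one.smul (IsSelfAdjoint.all a)).sub hD)
    fun x => ?_
  have h := (le_abs_self _).trans (D.abs_dotProduct_mulVec_le_frobenius x)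
  have hxx : 0 ≤ x ⬝ᵥ x := by
    simpa using dotProduct_star_self_nonneg x
  have h₂ := mul_le_mul_of_nonneg_right ha hxx
  simp only [star_trivial, sub_mulVec, smul_mulVec, one_mulVec, dotProduct_sub, dotProduct_smul,
    smul_eq_mul]
  linarith

theorem Matrix.dotProduct_mulVec_le_of_posSemidef {D : Matrix (Fin n) (Fin n) ℝ} {a : ℝ}
    (h : (a • (1 : Matrix (Fin n) (Fin n) ℝ) - D).PosSemidef) (x : Fin n → ℝ) :
    x ⬝ᵥ D *ᵥ x ≤ a * (x ⬝ᵥ x) := by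
  have h' := h.dotProduct_mulVec_nonneg x
  simp only [star_trivial, sub_mulVec, smul_mulVec, one_mulVec, dotProduct_sub, dotProduct_smul,
    smul_eq_mul] at h'
  linarith

theorem Matrix.IsHermitian.abs_apply_le {D : Matrix (Fin n) (Fin n) ℝ} (hD : D.IsHermitian)
    {a : ℝ} (h₁ : (a • (1 : Matrix (Fin n) (Fin n) ℝ) - D).PosSemidef)
    (h₂ : (a • (1 : Matrix (Fin n) (Fin n) ℝ) + D).PosSemidef) (i j : Fin n) : |D i j| ≤ a := by
  have hu := dotProduct_mulVec_le_of_posSemidef h₁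
  have hl : ∀ x, -(x ⬝ᵥ D *ᵥ x) ≤ a * (x ⬝ᵥ x) := fun x => by
    have h := dotProduct_mulVec_le_of_posSemidef (D := -D) (by rwa [sub_neg_eq_add]) x
    rwa [neg_mulVec, dotProduct_neg] at h
  have hs : D j i = D i j := by simpa using hD.apply i j
  have e : ∀ k l, (Pi.single k 1 : Fin n → ℝ) ⬝ᵥ D *ᵥ Pi.single l 1 = D k l := by simp
  have e1 : ∀ k, (Pi.single k 1 : Fin n → ℝ) ⬝ᵥ Pi.single k 1 = 1 := by simp
  have hp := hu (Pi.single i 1 + Pi.single j 1)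
  have hm := hl (Pi.single i 1 - Pi.single j 1)
  have hp' := hl (Pi.single i 1 + Pi.single j 1)
  have hm' := hu (Pi.single i 1 - Pi.single j 1)
  simp only [mulVec_add, mulVec_sub, add_dotProduct, sub_dotProduct, dotProduct_add,
    dotProduct_sub, e, e1, hs] at hp hm hp' hm'
  rw [abs_le]
  constructor <;> linarith

theorem Matrix.frobenius_norm_le_of_forall_abs_le {D : Matrix (Fin n) (Fin n) ℝ} {a : ℝ}
    (ha : 0 ≤ a) (h : ∀ i j, |D i j| ≤ a) : ‖D‖ ≤ n * a := by
  rw [frobenius_norm_def, ← Real.sqrt_eq_rpow]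
  refine Real.sqrt_le_iff.2 ⟨by positivity, ?_⟩
  calc ∑ i, ∑ j, ‖D i j‖ ^ (2 : ℝ) ≤ ∑ _i : Fin n, ∑ _j : Fin n, a ^ 2 :=
        Finset.sum_le_sum fun i _ => Finset.sum_le_sum fun j _ => by
          rw [Real.rpow_two, Real.norm_eq_abs]
          exact pow_le_pow_left₀ (abs_nonneg _) (h i j) 2
    _ = (n * a) ^ 2 := by simp; ring

theorem Matrix.isClosed_setOf_posSemidef :
    IsClosed {X : Matrix (Fin n) (Fin n) ℝ | X.PosSemidef} := by
  simp only [posSemidef_iff_dotProduct_mulVec, Set.ofPred_and, Set.ofPred_forall, IsHermitian]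
  exact (isClosed_eq (by fun_prop) continuous_id).inter
    (isClosed_iInter fun x => isClosed_le continuous_const (by fun_prop))

/-- The order interval `[0, R • 1]` of symmetric matrices. -/
def psdInterval (n : ℕ) (R : ℝ) : Set (Matrix (Fin n) (Fin n) ℝ) :=
  {X | X.PosSemidef ∧ (R • (1 : Matrix (Fin n) (Fin n) ℝ) - X).PosSemidef}

theorem convex_psdInterval (R : ℝ) : Convex ℝ (psdInterval n R) := by
  intro X hX Y hY a b ha hb hab
  refine ⟨(hX.1.smul ha).add (hY.1.smul hb), ?_⟩
  convert (hX.2.smul ha).add (hY.2.smul hb) using 1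
  rw [smul_sub, smul_sub, sub_add_sub_comm, ← add_smul, hab, one_smul]

theorem abs_apply_le_of_mem_psdInterval {R : ℝ} (hR : 0 ≤ R) {X : Matrix (Fin n) (Fin n) ℝ}
    (hX : X ∈ psdInterval n R) (i j : Fin n) : |X i j| ≤ R :=
  hX.1.isHermitian.abs_apply_le hX.2 ((PosSemidef.one.smul hR).add hX.1) i j

theorem isCompact_psdInterval {R : ℝ} (hR : 0 ≤ R) : IsCompact (psdInterval n R) := by
  have : ProperSpace (Matrix (Fin n) (Fin n) ℝ) := FiniteDimensional.proper ℝ _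
  refine Metric.isCompact_of_isClosed_isBounded ?_ ?_
  · exact isClosed_setOf_posSemidef.inter
      (isClosed_setOf_posSemidef.preimage (continuous_const.sub continuous_id))
  · refine (isBounded_iff_forall_norm_le).2 ⟨n * R, fun X hX => ?_⟩
    exact frobenius_norm_le_of_forall_abs_le hR (abs_apply_le_of_mem_psdInterval hR hX)

end LoewnerOrder

/-- The values at one instant of the coefficients of a stochastic Riccati equation. -/
structure RiccatiData (n k : ℕ) where
  (A₀ A₁ A₂ A₃ : Matrix (Fin n) (Fin n) ℝ)
  (B₀ B₁ B₂ B₃ : Matrix (Fin n) (Fin k) ℝ)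
  (Q : Matrix (Fin n) (Fin n) ℝ)
  (N : Matrix (Fin k) (Fin k) ℝ)

namespace RiccatiData

variable {n k : ℕ} (θ : RiccatiData n k)

/-- `N + ∑ Bᵢᵀ X Bᵢ`. -/
def nbar (X : Matrix (Fin n) (Fin n) ℝ) : Matrix (Fin k) (Fin k) ℝ :=
  θ.N + θ.B₁ᵀ * X * θ.B₁ + θ.B₂ᵀ * X * θ.B₂ + θ.B₃ᵀ * X * θ.B₃

/-- `B₀ᵀ X + ∑ Bᵢᵀ X Aᵢ`. -/
def cross (X : Matrix (Fin n) (Fin n) ℝ) : Matrix (Fin k) (Fin n) ℝ :=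
  θ.B₀ᵀ * X + θ.B₁ᵀ * X * θ.A₁ + θ.B₂ᵀ * X * θ.A₂ + θ.B₃ᵀ * X * θ.A₃

/-- The optimal feedback gain. -/
noncomputable def gain (X : Matrix (Fin n) (Fin n) ℝ) : Matrix (Fin k) (Fin n) ℝ :=
  -((θ.nbar X)⁻¹ * θ.cross X)

/-- The negative of the right-hand side of the Riccati equation. -/
noncomputable def field (X : Matrix (Fin n) (Fin n) ℝ) : Matrix (Fin n) (Fin n) ℝ :=
  X * θ.A₀ + θ.A₀ᵀ * X + θ.A₁ᵀ * X * θ.A₁ + θ.A₂ᵀ * X * θ.A₂ + θ.A₃ᵀ * X * θ.A₃ + θ.Q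
    - (X * θ.B₀ + θ.A₁ᵀ * X * θ.B₁ + θ.A₂ᵀ * X * θ.B₂ + θ.A₃ᵀ * X * θ.B₃)
      * (θ.nbar X)⁻¹ * θ.cross X

/-- The sum of the terms `Cᵢᵀ X Cᵢ` of the closed-loop Lyapunov operator, `Cᵢ = Aᵢ + Bᵢ K`. -/
def diffusion (K : Matrix (Fin k) (Fin n) ℝ) (X : Matrix (Fin n) (Fin n) ℝ) :
    Matrix (Fin n) (Fin n) ℝ :=
  (θ.A₁ + θ.B₁ * K)ᵀ * X * (θ.A₁ + θ.B₁ * K) + (θ.A₂ + θ.B₂ * K)ᵀ * X * (θ.A₂ + θ.B₂ * K)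
    + (θ.A₃ + θ.B₃ * K)ᵀ * X * (θ.A₃ + θ.B₃ * K)

/-- The closed-loop Lyapunov operator for the feedback gain `K`. -/
def lyapunov (K : Matrix (Fin k) (Fin n) ℝ) (X : Matrix (Fin n) (Fin n) ℝ) :
    Matrix (Fin n) (Fin n) ℝ :=
  X * (θ.A₀ + θ.B₀ * K) + (θ.A₀ + θ.B₀ * K)ᵀ * X + θ.diffusion K X

/-- The closed-loop Lyapunov operator with the running cost of the feedback gain `K`. -/
def costField (K : Matrix (Fin k) (Fin n) ℝ) (X : Matrix (Fin n) (Fin n) ℝ) :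
    Matrix (Fin n) (Fin n) ℝ :=
  θ.lyapunov K X + θ.Q + Kᵀ * θ.N * K

variable {θ} {X Y : Matrix (Fin n) (Fin n) ℝ}

theorem nbar_posDef (hN : θ.N.PosDef) (hX : X.PosSemidef) : (θ.nbar X).PosDef := by
  have h : ∀ B : Matrix (Fin n) (Fin k) ℝ, (Bᵀ * X * B).PosSemidef := fun B => by
    simpa using hX.conjTranspose_mul_mul_same B
  exact ((hN.add_posSemidef (h _)).add_posSemidef (h _)).add_posSemidef (h _)

theorem costField_eq (hN : θ.N.PosDef) (hX : X.PosSemidef) (K : Matrix (Fin k) (Fin n) ℝ) :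
    θ.costField K X = θ.field X + (K - θ.gain X)ᵀ * θ.nbar X * (K - θ.gain X) := by
  have hpd := nbar_posDef hN hX
  have hu : IsUnit (θ.nbar X).det := (isUnit_iff_isUnit_det _).1 hpd.isUnit
  have hXs : Xᵀ = X := by simpa using hX.isHermitian.eq
  have hNs : (θ.nbar X)ᵀ = θ.nbar X := by simpa using hpd.isHermitian.eq
  have hS : (θ.cross X)ᵀ = X * θ.B₀ + θ.A₁ᵀ * X * θ.B₁ + θ.A₂ᵀ * X * θ.B₂ + θ.A₃ᵀ * X * θ.B₃ := by
    simp [cross, hXs, Matrix.mul_assoc]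
  have hexpand : θ.costField K X = X * θ.A₀ + θ.A₀ᵀ * X + θ.A₁ᵀ * X * θ.A₁ + θ.A₂ᵀ * X * θ.A₂
      + θ.A₃ᵀ * X * θ.A₃ + θ.Q + (Kᵀ * θ.cross X + (θ.cross X)ᵀ * K + Kᵀ * θ.nbar X * K) := by
    rw [hS]
    simp only [costField, lyapunov, diffusion, cross, nbar, transpose_add, transpose_mul,
      Matrix.mul_add, Matrix.add_mul, Matrix.mul_assoc]
    abel
  have hsq : (K - θ.gain X)ᵀ * θ.nbar X * (K - θ.gain X) = Kᵀ * θ.cross X + (θ.cross X)ᵀ * K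
      + Kᵀ * θ.nbar X * K + (θ.cross X)ᵀ * (θ.nbar X)⁻¹ * θ.cross X := by
    simp only [gain, sub_neg_eq_add, transpose_add, transpose_mul, transpose_nonsing_inv, hNs,
      Matrix.mul_add, Matrix.add_mul, Matrix.mul_assoc, mul_nonsing_inv_cancel_left _ _ hu,
      nonsing_inv_mul_cancel_left _ _ hu]
    abel
  rw [hexpand, hsq, field, ← hS]
  abel

theorem costField_gain (hN : θ.N.PosDef) (hX : X.PosSemidef) :
    θ.costField (θ.gain X) X = θ.field X := by
  simp [costField_eq hN hX]

theorem costField_sub_field_posSemidef (hN : θ.N.PosDef) (hX : X.PosSemidef)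
    (K : Matrix (Fin k) (Fin n) ℝ) : (θ.costField K X - θ.field X).PosSemidef := by
  rw [costField_eq hN hX, add_sub_cancel_left]
  simpa using (nbar_posDef hN hX).posSemidef.conjTranspose_mul_mul_same (K - θ.gain X)

theorem costField_sub (K : Matrix (Fin k) (Fin n) ℝ) :
    θ.costField K X - θ.costField K Y = θ.lyapunov K (X - Y) := by
  simp only [costField, lyapunov, diffusion, Matrix.mul_sub, Matrix.sub_mul]
  abel

theorem lyapunov_isHermitian (hX : X.IsHermitian) (K : Matrix (Fin k) (Fin n) ℝ) :
    (θ.lyapunov K X).IsHermitian := by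
  have hXs : Xᵀ = X := by simpa using hX.eq
  simp only [IsHermitian, conjTranspose_eq_transpose_of_trivial, lyapunov, diffusion,
    transpose_add, transpose_mul, transpose_transpose, hXs, Matrix.mul_add, Matrix.add_mul,
    Matrix.mul_assoc]
  abel

theorem field_isHermitian (hQ : θ.Q.IsHermitian) (hN : θ.N.PosDef) (hX : X.PosSemidef) :
    (θ.field X).IsHermitian := by
  rw [← costField_gain hN hX]
  refine ((lyapunov_isHermitian hX.isHermitian _).add hQ).add ?_
  simpa using isHermitian_conjTranspose_mul_mul (θ.gain X) hN.isHermitian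

open scoped Matrix.Norms.Frobenius

/-- A bound for the Frobenius operator norm of `RiccatiData.lyapunov`. -/
noncomputable def lyapunovBound (θ : RiccatiData n k) (K : Matrix (Fin k) (Fin n) ℝ) : ℝ :=
  2 * ‖θ.A₀ + θ.B₀ * K‖ + ‖θ.A₁ + θ.B₁ * K‖ ^ 2 + ‖θ.A₂ + θ.B₂ * K‖ ^ 2
    + ‖θ.A₃ + θ.B₃ * K‖ ^ 2

theorem norm_lyapunov_le (K : Matrix (Fin k) (Fin n) ℝ) (X : Matrix (Fin n) (Fin n) ℝ) :
    ‖θ.lyapunov K X‖ ≤ θ.lyapunovBound K * ‖X‖ := by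
  have hconj : ∀ C : Matrix (Fin n) (Fin n) ℝ, ‖Cᵀ * X * C‖ ≤ ‖C‖ ^ 2 * ‖X‖ := fun C => by
    calc ‖Cᵀ * X * C‖ ≤ ‖Cᵀ‖ * ‖X‖ * ‖C‖ := norm_mul₃_le
      _ = ‖C‖ ^ 2 * ‖X‖ := by rw [frobenius_norm_transpose]; ring
  have h₁ := norm_mul_le X (θ.A₀ + θ.B₀ * K)
  have h₂ := norm_mul_le (θ.A₀ + θ.B₀ * K)ᵀ X
  rw [frobenius_norm_transpose] at h₂
  have h₃ := hconj (θ.A₁ + θ.B₁ * K)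
  have h₄ := hconj (θ.A₂ + θ.B₂ * K)
  have h₅ := hconj (θ.A₃ + θ.B₃ * K)
  have h₆ := (norm_add₃_le (a := X * (θ.A₀ + θ.B₀ * K)) (b := (θ.A₀ + θ.B₀ * K)ᵀ * X)
    (c := θ.diffusion K X))
  have h₇ := (norm_add₃_le (a := (θ.A₁ + θ.B₁ * K)ᵀ * X * (θ.A₁ + θ.B₁ * K))
    (b := (θ.A₂ + θ.B₂ * K)ᵀ * X * (θ.A₂ + θ.B₂ * K))
    (c := (θ.A₃ + θ.B₃ * K)ᵀ * X * (θ.A₃ + θ.B₃ * K)))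
  rw [← diffusion] at h₇
  rw [← lyapunov] at h₆
  rw [lyapunovBound]
  linarith

theorem smul_one_add_field_sub_posSemidef (hN : θ.N.PosDef) (hX : X.PosSemidef)
    (hY : Y.PosSemidef) {a : ℝ} (ha : θ.lyapunovBound (θ.gain X) ≤ a) :
    ((a * ‖X - Y‖) • (1 : Matrix (Fin n) (Fin n) ℝ) + (θ.field X - θ.field Y)).PosSemidef := by
  have h₁ := costField_sub_field_posSemidef hN hY (θ.gain X)
  have h₂ : ‖θ.lyapunov (θ.gain X) (Y - X)‖ ≤ a * ‖X - Y‖ := by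
    refine (norm_lyapunov_le _ _).trans ?_
    rw [norm_sub_rev]
    exact mul_le_mul_of_nonneg_right ha (norm_nonneg _)
  have h₃ := (lyapunov_isHermitian (hY.isHermitian.sub hX.isHermitian)
    (θ.gain X)).posSemidef_smul_one_sub h₂
  rw [← costField_sub, costField_gain hN hX] at h₃
  convert h₃.add h₁ using 1
  abel

/-- The Riccati field is Lipschitz wherever the optimal gain is bounded. -/
theorem norm_field_sub_le (hQ : θ.Q.IsHermitian) (hN : θ.N.PosDef) (hX : X.PosSemidef)
    (hY : Y.PosSemidef) {a : ℝ} (haX : θ.lyapunovBound (θ.gain X) ≤ a)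
    (haY : θ.lyapunovBound (θ.gain Y) ≤ a) :
    ‖θ.field X - θ.field Y‖ ≤ n * a * ‖X - Y‖ := by
  have ha : 0 ≤ a := le_trans (by unfold lyapunovBound; positivity) haX
  have h₁ := smul_one_add_field_sub_posSemidef hN hX hY haX
  have h₂ := smul_one_add_field_sub_posSemidef hN hY hX haY
  rw [norm_sub_rev, ← neg_sub (θ.field X), ← sub_eq_add_neg] at h₂
  rw [mul_assoc]
  exact frobenius_norm_le_of_forall_abs_le (by positivity)
    (((field_isHermitian hQ hN hX).sub (field_isHermitian hQ hN hY)).abs_apply_le h₂ h₁)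

theorem diffusion_posSemidef (hX : X.PosSemidef) (K : Matrix (Fin k) (Fin n) ℝ) :
    (θ.diffusion K X).PosSemidef := by
  have h : ∀ C : Matrix (Fin n) (Fin n) ℝ, (Cᵀ * X * C).PosSemidef := fun C => by
    simpa using hX.conjTranspose_mul_mul_same C
  exact ((h _).add (h _)).add (h _)

theorem add_smul_field_add_posSemidef (hQ : θ.Q.PosSemidef) (hN : θ.N.PosDef) (hX : X.PosSemidef)
    {h : ℝ} (h0 : 0 ≤ h) :
    (X + h • θ.field X + h ^ 2 • ((θ.A₀ + θ.B₀ * θ.gain X)ᵀ * X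
      * (θ.A₀ + θ.B₀ * θ.gain X))).PosSemidef := by
  rw [← costField_gain hN hX, costField, lyapunov]
  generalize θ.gain X = K
  generalize θ.A₀ + θ.B₀ * K = M
  have hcost : (Kᵀ * θ.N * K).PosSemidef := by
    simpa using hN.posSemidef.conjTranspose_mul_mul_same K
  have hI : ((1 + h • M)ᵀ * X * (1 + h • M)).PosSemidef := by
    rw [← conjTranspose_eq_transpose_of_trivial]
    exact hX.conjTranspose_mul_mul_same (1 + h • M)
  have hsum := hI.add ((((diffusion_posSemidef (θ := θ) hX K).add hQ).add hcost).smul h0)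
  have heq : X + h • (X * M + Mᵀ * X + θ.diffusion K X + θ.Q + Kᵀ * θ.N * K)
      + h ^ 2 • (Mᵀ * X * M) = (1 + h • M)ᵀ * X * (1 + h • M)
      + h • (θ.diffusion K X + θ.Q + Kᵀ * θ.N * K) := by
    simp only [transpose_add, transpose_one, transpose_smul, Matrix.add_mul, Matrix.mul_add,
      Matrix.one_mul, Matrix.mul_one, Matrix.smul_mul, Matrix.mul_smul, smul_add, smul_smul, sq]
    abel
  rwa [heq]

open Filter Topology in
/-- The order interval `[0, R • 1]` is subtangent to the Riccati field when the open-loop field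
points strictly inwards at the upper face. -/
theorem exists_eventually_add_smul_field_mem (hQ : θ.Q.PosSemidef) (hN : θ.N.PosDef) {R c : ℝ}
    (hX : X ∈ psdInterval n R)
    (hup : (c • (R • (1 : Matrix (Fin n) (Fin n) ℝ) - X) - θ.costField 0 X - 1).PosSemidef) :
    ∃ W : Matrix (Fin n) (Fin n) ℝ, ∀ᶠ h in 𝓝[>] (0 : ℝ),
      X + h • θ.field X + h ^ 2 • W ∈ psdInterval n R := by
  obtain ⟨hX0, hXR⟩ := hX
  have hW : ((θ.A₀ + θ.B₀ * θ.gain X)ᵀ * X * (θ.A₀ + θ.B₀ * θ.gain X)).IsHermitian := by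
    simpa using isHermitian_conjTranspose_mul_mul (θ.A₀ + θ.B₀ * θ.gain X) hX0.isHermitian
  have hpos := fun h => add_smul_field_add_posSemidef (h := h) hQ hN hX0
  refine ⟨(θ.A₀ + θ.B₀ * θ.gain X)ᵀ * X * (θ.A₀ + θ.B₀ * θ.gain X), ?_⟩
  generalize (θ.A₀ + θ.B₀ * θ.gain X)ᵀ * X * (θ.A₀ + θ.B₀ * θ.gain X) = W at hW hpos ⊢
  have hsmall : ∀ a : ℝ, ∀ᶠ h in 𝓝[>] (0 : ℝ), h * a < 1 := fun a => by
    refine Tendsto.eventually_lt_const (v := 0) one_pos ?_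
    exact ((continuous_id.mul continuous_const).tendsto' 0 0 (by simp)).mono_left
      nhdsWithin_le_nhds
  filter_upwards [hsmall c, hsmall ‖W‖, self_mem_nhdsWithin] with h h₁ h₂ (h0 : 0 < h)
  refine ⟨hpos h h0.le, ?_⟩
  have t₁ := hXR.smul (sub_nonneg.2 h₁.le)
  have t₂ := hup.smul h0.le
  have t₃ := (costField_sub_field_posSemidef hN hX0 0).smul h0.le
  have t₄ := (PosSemidef.one (n := Fin n) (R := ℝ)).smul (mul_nonneg h0.le (sub_nonneg.2 h₂.le))
  have t₅ := (hW.posSemidef_smul_one_sub le_rfl).smul (sq_nonneg h)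
  convert (((t₁.add t₂).add t₃).add t₄).add t₅ using 1
  module

/-- Continuity on a set of all the coefficients. -/
structure ContinuousOnData {Z : Type*} [TopologicalSpace Z] (θ : Z → RiccatiData n k)
    (s : Set Z) : Prop where
  A₀ : ContinuousOn (fun z => (θ z).A₀) s
  A₁ : ContinuousOn (fun z => (θ z).A₁) s
  A₂ : ContinuousOn (fun z => (θ z).A₂) s
  A₃ : ContinuousOn (fun z => (θ z).A₃) s
  B₀ : ContinuousOn (fun z => (θ z).B₀) s
  B₁ : ContinuousOn (fun z => (θ z).B₁) s
  B₂ : ContinuousOn (fun z => (θ z).B₂) s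
  B₃ : ContinuousOn (fun z => (θ z).B₃) s
  Q : ContinuousOn (fun z => (θ z).Q) s
  N : ContinuousOn (fun z => (θ z).N) s

namespace ContinuousOnData

variable {Z : Type*} [TopologicalSpace Z] {θ : Z → RiccatiData n k} {s : Set Z}
  {X : Z → Matrix (Fin n) (Fin n) ℝ}

theorem comp {Z' : Type*} [TopologicalSpace Z'] {g : Z' → Z} {s' : Set Z'}
    (h : ContinuousOnData θ s) (hg : ContinuousOn g s') (hs : Set.MapsTo g s' s) :
    ContinuousOnData (fun z => θ (g z)) s' :=
  ⟨h.A₀.comp hg hs, h.A₁.comp hg hs, h.A₂.comp hg hs, h.A₃.comp hg hs, h.B₀.comp hg hs,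
    h.B₁.comp hg hs, h.B₂.comp hg hs, h.B₃.comp hg hs, h.Q.comp hg hs, h.N.comp hg hs⟩

theorem inv_nbar (h : ContinuousOnData θ s) (hX : ContinuousOn X s)
    (hN : ∀ z ∈ s, (θ z).N.PosDef) (hX0 : ∀ z ∈ s, (X z).PosSemidef) :
    ContinuousOn (fun z => ((θ z).nbar (X z))⁻¹) s := by
  obtain ⟨hA₀, hA₁, hA₂, hA₃, hB₀, hB₁, hB₂, hB₃, hQ, hN'⟩ := h
  intro z hz
  have hdet : ((θ z).nbar (X z)).det ≠ 0 := (nbar_posDef (hN z hz) (hX0 z hz)).det_pos.ne'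
  refine (continuousAt_matrix_inv _ ?_).comp_continuousWithinAt
    (ContinuousOn.continuousWithinAt (f := fun z => (θ z).nbar (X z)) ?_ hz)
  · simpa only [Ring.inverse_eq_inv'] using continuousAt_inv₀ hdet
  · unfold nbar
    fun_prop

theorem cross (h : ContinuousOnData θ s) (hX : ContinuousOn X s) :
    ContinuousOn (fun z => (θ z).cross (X z)) s := by
  obtain ⟨hA₀, hA₁, hA₂, hA₃, hB₀, hB₁, hB₂, hB₃, hQ, hN⟩ := h
  unfold RiccatiData.cross
  fun_prop

theorem gain (h : ContinuousOnData θ s) (hX : ContinuousOn X s)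
    (hN : ∀ z ∈ s, (θ z).N.PosDef) (hX0 : ∀ z ∈ s, (X z).PosSemidef) :
    ContinuousOn (fun z => (θ z).gain (X z)) s := by
  have hinv := h.inv_nbar hX hN hX0
  have hcross := h.cross hX
  unfold RiccatiData.gain
  fun_prop

theorem field (h : ContinuousOnData θ s) (hX : ContinuousOn X s)
    (hN : ∀ z ∈ s, (θ z).N.PosDef) (hX0 : ∀ z ∈ s, (X z).PosSemidef) :
    ContinuousOn (fun z => (θ z).field (X z)) s := by
  have hinv := h.inv_nbar hX hN hX0
  have hcross := h.cross hX
  obtain ⟨hA₀, hA₁, hA₂, hA₃, hB₀, hB₁, hB₂, hB₃, hQ, hN'⟩ := h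
  unfold RiccatiData.field
  fun_prop

end ContinuousOnData

/-- On an order interval the Riccati field is Lipschitz uniformly in time. -/
theorem exists_lipschitzOnWith_field {θ : ℝ → RiccatiData n k} {T R : ℝ} (hR : 0 ≤ R)
    (hθ : ContinuousOnData θ (Set.Icc 0 T)) (hQ : ∀ t ∈ Set.Icc 0 T, (θ t).Q.PosSemidef)
    (hN : ∀ t ∈ Set.Icc 0 T, (θ t).N.PosDef) :
    ∃ L : NNReal, ∀ t ∈ Set.Icc 0 T, LipschitzOnWith L (θ t).field (psdInterval n R) := by
  have hcont : ContinuousOn (fun z : ℝ × Matrix (Fin n) (Fin n) ℝ =>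
      (θ z.1).lyapunovBound ((θ z.1).gain z.2)) (Set.Icc 0 T ×ˢ psdInterval n R) := by
    have h := hθ.comp continuousOn_fst (s' := Set.Icc 0 T ×ˢ psdInterval n R) fun z hz => hz.1
    have hg := h.gain continuousOn_snd (fun z hz => hN _ hz.1) fun z hz => hz.2.1
    obtain ⟨hA₀, hA₁, hA₂, hA₃, hB₀, hB₁, hB₂, hB₃, -, -⟩ := h
    unfold lyapunovBound
    fun_prop
  obtain ⟨a, ha⟩ := (isCompact_Icc.prod (isCompact_psdInterval hR)).bddAbove_image hcont
  have hle : ∀ t ∈ Set.Icc 0 T, ∀ X ∈ psdInterval n R, (θ t).lyapunovBound ((θ t).gain X) ≤ a :=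
    fun t ht X hX => ha ⟨(t, X), ⟨ht, hX⟩, rfl⟩
  refine ⟨(n * a).toNNReal, fun t ht => LipschitzOnWith.of_dist_le_mul fun X hX Y hY => ?_⟩
  rw [dist_eq_norm, dist_eq_norm]
  exact (norm_field_sub_le (hQ t ht).isHermitian (hN t ht) hX.1 hY.1 (hle t ht X hX)
    (hle t ht Y hY)).trans (mul_le_mul_of_nonneg_right (Real.le_coe_toNNReal _) (norm_nonneg _))

/-- The coefficients of the equation satisfied by `r⁻¹ • X`, with `r = exp (c * t)`, when `X` solves
the Riccati equation with coefficients `θ`. -/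
noncomputable def discount (θ : RiccatiData n k) (c r : ℝ) : RiccatiData n k :=
  { θ with A₀ := θ.A₀ - (c / 2) • 1, Q := r⁻¹ • θ.Q, N := r⁻¹ • θ.N }

theorem field_smul (hN : θ.N.PosDef) (hX : X.PosSemidef) (c : ℝ) {r : ℝ} (hr : 0 < r) :
    θ.field (r • X) = r • ((θ.discount c r).field X + c • X) := by
  have hN' : (θ.discount c r).N.PosDef := hN.smul (inv_pos.2 hr)
  have hu := (isUnit_iff_isUnit_det _).1 (nbar_posDef hN' hX).isUnit
  have hnbar : θ.nbar (r • X) = r • (θ.discount c r).nbar X := by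
    simp [nbar, discount, smul_add, smul_smul, hr.ne']
  have hinv : (θ.nbar (r • X))⁻¹ = r⁻¹ • ((θ.discount c r).nbar X)⁻¹ := by
    rw [hnbar]
    exact Matrix.inv_smul' _ (Units.mk0 r hr.ne') hu
  have hcross : θ.cross (r • X) = r • (θ.discount c r).cross X := by
    simp [cross, discount, smul_add]
  rw [field, hinv, hcross, field]
  generalize ((θ.discount c r).nbar X)⁻¹ = V
  generalize (θ.discount c r).cross X = S
  simp only [discount, Matrix.mul_sub, Matrix.sub_mul, transpose_sub, transpose_smul,
    transpose_one, Matrix.mul_smul, Matrix.smul_mul, Matrix.mul_one, Matrix.one_mul,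
    Matrix.add_mul, smul_add, smul_sub, smul_smul, mul_inv_cancel₀ hr.ne', inv_mul_cancel₀ hr.ne',
    one_smul]
  module

theorem costField_discount_zero (c r : ℝ) :
    (θ.discount c r).costField 0 X = θ.lyapunov 0 X - c • X + r⁻¹ • θ.Q := by
  simp only [costField, lyapunov, diffusion, discount, Matrix.mul_zero, add_zero,
    Matrix.mul_sub, Matrix.sub_mul, transpose_sub, transpose_smul, transpose_one,
    Matrix.mul_smul, Matrix.smul_mul, Matrix.mul_one, Matrix.one_mul]
  module

theorem mem_psdInterval {R : ℝ} (hX : X.PosSemidef) (hR : ‖X‖ ≤ R) : X ∈ psdInterval n R :=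
  ⟨hX, hX.isHermitian.posSemidef_smul_one_sub hR⟩

/-- Global solvability of the initial value problem for the Riccati equation. -/
theorem exists_forall_hasDerivWithinAt_field {θ : ℝ → RiccatiData n k} {T : ℝ} (hT : 0 ≤ T)
    (hθ : ContinuousOnData θ (Set.Icc 0 T)) (hQ : ∀ t ∈ Set.Icc 0 T, (θ t).Q.PosSemidef)
    (hN : ∀ t ∈ Set.Icc 0 T, (θ t).N.PosDef) {G : Matrix (Fin n) (Fin n) ℝ}
    (hG : G.PosSemidef) :
    ∃ X : ℝ → Matrix (Fin n) (Fin n) ℝ, X 0 = G ∧ (∀ t ∈ Set.Icc 0 T, (X t).PosSemidef) ∧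
      ∀ t ∈ Set.Icc 0 T, HasDerivWithinAt X ((θ t).field (X t)) (Set.Icc 0 T) t := by
  obtain ⟨q, hq⟩ := isCompact_Icc.exists_bound_of_continuousOn hθ.Q
  obtain ⟨a, ha⟩ := isCompact_Icc.exists_bound_of_continuousOn
    (f := fun t => (θ t).lyapunovBound 0) (s := Set.Icc 0 T) <| by
      obtain ⟨hA₀, hA₁, hA₂, hA₃, hB₀, hB₁, hB₂, hB₃, -, -⟩ := hθ
      unfold lyapunovBound
      fun_prop
  have h0 : (0 : ℝ) ∈ Set.Icc 0 T := ⟨le_rfl, hT⟩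
  have hq0 : 0 ≤ q := (norm_nonneg _).trans (hq 0 h0)
  have ha0 : 0 ≤ a := (norm_nonneg _).trans (ha 0 h0)
  obtain ⟨R, hR0, hGR⟩ : ∃ R : ℝ, 0 < R ∧ ‖G‖ ≤ R := ⟨‖G‖ + 1, by positivity, by linarith⟩
  obtain ⟨c, hc0, hcR⟩ : ∃ c : ℝ, 0 ≤ c ∧ c * R = a * (n * R) + q + 1 :=
    ⟨(a * (n * R) + q + 1) / R, by positivity, div_mul_cancel₀ _ hR0.ne'⟩
  set θ' : ℝ → RiccatiData n k := fun t => (θ t).discount c (Real.exp (c * t)) with hθ'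
  have hexp : ∀ t ∈ Set.Icc 0 T, (Real.exp (c * t))⁻¹ ≤ 1 := fun t ht =>
    inv_le_one_of_one_le₀ (Real.one_le_exp (mul_nonneg hc0 ht.1))
  have hcont : ContinuousOnData θ' (Set.Icc 0 T) := by
    have he : ContinuousOn (fun t : ℝ => (Real.exp (c * t))⁻¹) (Set.Icc 0 T) :=
      Continuous.continuousOn (by fun_prop (disch := intro; positivity))
    exact { hθ with
      A₀ := hθ.A₀.sub continuousOn_const
      Q := he.smul hθ.Q
      N := he.smul hθ.N }
  have hQ' : ∀ t ∈ Set.Icc 0 T, (θ' t).Q.PosSemidef := fun t ht =>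
    (hQ t ht).smul (inv_nonneg.2 (Real.exp_nonneg _))
  have hN' : ∀ t ∈ Set.Icc 0 T, (θ' t).N.PosDef := fun t ht =>
    (hN t ht).smul (inv_pos.2 (Real.exp_pos _))
  obtain ⟨L, hL⟩ := exists_lipschitzOnWith_field hR0.le hcont hQ' hN'
  obtain ⟨Y, hY0, hYmem, hY⟩ := exists_forall_hasDerivWithinAt_mem_of_tangent
    (f := fun t X => (θ' t).field X) (isCompact_psdInterval hR0.le) (convex_psdInterval R)
    (mem_psdInterval hG hGR) hT
    (fun X hX => hcont.field continuousOn_const hN' fun _ _ => hX.1) hL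
    (fun t ht X hX => exists_eventually_add_smul_field_mem (c := c) (hQ' t ht) (hN' t ht) hX <| by
      have hX' : ‖X‖ ≤ n * R :=
        frobenius_norm_le_of_forall_abs_le hR0.le (abs_apply_le_of_mem_psdInterval hR0.le hX)
      have h₁ : ‖(θ t).lyapunov 0 X‖ ≤ a * (n * R) := (norm_lyapunov_le _ _).trans
        (mul_le_mul ((le_abs_self _).trans (ha t ht)) hX' (norm_nonneg _) ha0)
      have h₂ : ‖(θ' t).Q‖ ≤ q := by
        change ‖(Real.exp (c * t))⁻¹ • (θ t).Q‖ ≤ q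
        rw [norm_smul, Real.norm_of_nonneg (inv_nonneg.2 (Real.exp_nonneg _))]
        exact (mul_le_of_le_one_left (norm_nonneg _) (hexp t ht)).trans (hq t ht)
      have h₃ := ((lyapunov_isHermitian (θ := θ t) hX.1.isHermitian 0).add
        (hQ' t ht).isHermitian).posSemidef_smul_one_sub
        (a := c * R - 1) ((norm_add_le _ _).trans (by linarith [h₁, h₂]))
      rw [costField_discount_zero]
      convert h₃ using 1
      change _ = (c * R - 1) • 1 - ((θ t).lyapunov 0 X + (Real.exp (c * t))⁻¹ • (θ t).Q)
      module)
  refine ⟨fun t => Real.exp (c * t) • Y t, by simp [hY0],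
    fun t ht => (hYmem t ht).1.smul (Real.exp_nonneg _), fun t ht => ?_⟩
  have he : HasDerivWithinAt (fun t => Real.exp (c * t)) (Real.exp (c * t) * c)
      (Set.Icc 0 T) t := by
    simpa using (((hasDerivAt_id t).const_mul c).exp).hasDerivWithinAt
  change HasDerivWithinAt _ ((θ t).field (Real.exp (c * t) • Y t)) _ _
  rw [field_smul (hN t ht) (hYmem t ht).1 c (Real.exp_pos _), smul_add, smul_smul]
  exact he.smul (hY t ht)

/-- Uniqueness of the positive semidefinite solution of the terminal value problem. -/
theorem eqOn_of_hasDerivWithinAt_field {θ : ℝ → RiccatiData n k} {T : ℝ}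
    (hθ : ContinuousOnData θ (Set.Icc 0 T)) (hQ : ∀ t ∈ Set.Icc 0 T, (θ t).Q.PosSemidef)
    (hN : ∀ t ∈ Set.Icc 0 T, (θ t).N.PosDef) {X Y : ℝ → Matrix (Fin n) (Fin n) ℝ}
    (hX0 : ∀ t ∈ Set.Icc 0 T, (X t).PosSemidef) (hY0 : ∀ t ∈ Set.Icc 0 T, (Y t).PosSemidef)
    (hX : ∀ t ∈ Set.Icc 0 T, HasDerivWithinAt X (-(θ t).field (X t)) (Set.Icc 0 T) t)
    (hY : ∀ t ∈ Set.Icc 0 T, HasDerivWithinAt Y (-(θ t).field (Y t)) (Set.Icc 0 T) t)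
    (hXY : X T = Y T) : Set.EqOn X Y (Set.Icc 0 T) := by
  have hXc : ContinuousOn X (Set.Icc 0 T) := fun t ht => (hX t ht).continuousWithinAt
  have hYc : ContinuousOn Y (Set.Icc 0 T) := fun t ht => (hY t ht).continuousWithinAt
  obtain ⟨a, ha⟩ := isCompact_Icc.exists_bound_of_continuousOn hXc
  obtain ⟨b, hb⟩ := isCompact_Icc.exists_bound_of_continuousOn hYc
  obtain ⟨L, hL⟩ := exists_lipschitzOnWith_field (le_max_right (max a b) 0) hθ hQ hN
  have hIic : ∀ t ∈ Set.Ioc 0 T, Set.Icc 0 T ∈ nhdsWithin t (Set.Iic t) := fun t ht =>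
    Filter.mem_of_superset (Icc_mem_nhdsLE ht.1) (Set.Icc_subset_Icc_right ht.2)
  have hI : Set.Ioc 0 T ⊆ Set.Icc 0 T := Set.Ioc_subset_Icc_self
  exact ODE_solution_unique_of_mem_Icc_left (v := fun t X => -(θ t).field X)
    (s := fun _ => psdInterval n (max (max a b) 0)) (fun t ht => (hL t (hI ht)).neg)
    hXc (fun t ht => (hX t (hI ht)).mono_of_mem_nhdsWithin (hIic t ht))
    (fun t ht => mem_psdInterval (hX0 t (hI ht)) ((ha t (hI ht)).trans (by simp)))
    hYc (fun t ht => (hY t (hI ht)).mono_of_mem_nhdsWithin (hIic t ht))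
    (fun t ht => mem_psdInterval (hY0 t (hI ht)) ((hb t (hI ht)).trans (by simp))) hXY

end RiccatiData

open scoped Matrix.Norms.Frobenius in
/-- A matrix-valued function is differentiable exactly when its entries are. -/
theorem Matrix.hasDerivWithinAt_iff_apply {m n : ℕ} {X : ℝ → Matrix (Fin m) (Fin n) ℝ}
    {D : Matrix (Fin m) (Fin n) ℝ} {s : Set ℝ} {t : ℝ} :
    HasDerivWithinAt X D s t ↔ ∀ i j, HasDerivWithinAt (fun z => X z i j) (D i j) s t := by
  simp only [hasDerivWithinAt_iff_tendsto_slope (F := ℝ)]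
  exact hasDerivWithinAt_iff_tendsto_slope.trans <|
    (tendsto_pi_nhds (f := fun z => slope X t z) (g := D)).trans
      (forall_congr' fun i => tendsto_pi_nhds (f := fun z => slope X t z i) (g := D i))

/-- Solvability of the follower's matrix Riccati equation (2.17): under continuity and
(semi)definiteness assumptions on the coefficients, there exists a solution on `[0,T]`,
and it is unique on `[0,T]`. -/
theorem matrix_riccati_solvable {n k : ℕ} (T : ℝ) (hT : 0 < T)
    (A₀ A₁ A₂ A₃ : ℝ → Matrix (Fin n) (Fin n) ℝ)
    (B₀ B₁ B₂ B₃ : ℝ → Matrix (Fin n) (Fin k) ℝ)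
    (Q₁ : ℝ → Matrix (Fin n) (Fin n) ℝ)
    (N₁ : ℝ → Matrix (Fin k) (Fin k) ℝ)
    (G₁ : Matrix (Fin n) (Fin n) ℝ)
    (hA₀ : Continuous A₀) (hA₁ : Continuous A₁) (hA₂ : Continuous A₂) (hA₃ : Continuous A₃)
    (hB₀ : Continuous B₀) (hB₁ : Continuous B₁) (hB₂ : Continuous B₂) (hB₃ : Continuous B₃)
    (hQ₁cont : Continuous Q₁) (hQ₁pos : ∀ t, (Q₁ t).PosSemidef)
    (hN₁cont : Continuous N₁) (hN₁symm : ∀ t, (N₁ t).IsHermitian)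
    (δ : ℝ) (hδ : 0 < δ)
    (hN₁coer : ∀ t, (N₁ t - δ • (1 : Matrix (Fin k) (Fin k) ℝ)).PosSemidef)
    (hG₁ : G₁.PosSemidef) :
    (∃ P : ℝ → Matrix (Fin n) (Fin n) ℝ,
      IsRiccatiSolution T A₀ A₁ A₂ A₃ B₀ B₁ B₂ B₃ Q₁ N₁ G₁ P) ∧
    (∀ P P' : ℝ → Matrix (Fin n) (Fin n) ℝ,
      IsRiccatiSolution T A₀ A₁ A₂ A₃ B₀ B₁ B₂ B₃ Q₁ N₁ G₁ P →
      IsRiccatiSolution T A₀ A₁ A₂ A₃ B₀ B₁ B₂ B₃ Q₁ N₁ G₁ P' →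
      ∀ t ∈ Set.Icc (0 : ℝ) T, P t = P' t) := by
  let θ : ℝ → RiccatiData n k := fun t =>
    ⟨A₀ t, A₁ t, A₂ t, A₃ t, B₀ t, B₁ t, B₂ t, B₃ t, Q₁ t, N₁ t⟩
  have hθ : ∀ s, RiccatiData.ContinuousOnData θ s := fun s =>
    ⟨hA₀.continuousOn, hA₁.continuousOn, hA₂.continuousOn, hA₃.continuousOn, hB₀.continuousOn,
      hB₁.continuousOn, hB₂.continuousOn, hB₃.continuousOn, hQ₁cont.continuousOn,
      hN₁cont.continuousOn⟩
  have hN : ∀ t, (θ t).N.PosDef := fun t => by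
    have h := PosDef.posSemidef_add (hN₁coer t) ((PosDef.one (n := Fin k) (R := ℝ)).smul hδ)
    rwa [sub_add_cancel] at h
  have hderiv : ∀ P, IsRiccatiSolution T A₀ A₁ A₂ A₃ B₀ B₁ B₂ B₃ Q₁ N₁ G₁ P →
      ∀ t ∈ Set.Icc 0 T, HasDerivWithinAt P (-(θ t).field (P t)) (Set.Icc 0 T) t :=
    fun P hP t ht => hasDerivWithinAt_iff_apply.2 (hP.2.2.2 t ht)
  refine ⟨?_, fun P P' hP hP' => RiccatiData.eqOn_of_hasDerivWithinAt_field (hθ _)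
    (fun t _ => hQ₁pos t) (fun t _ => hN t) hP.1 hP'.1 (hderiv P hP) (hderiv P' hP')
    (hP.2.1.trans hP'.2.1.symm)⟩
  have hmaps : Set.MapsTo (fun t => T - t) (Set.Icc 0 T) (Set.Icc 0 T) := fun t ht =>
    ⟨sub_nonneg.2 ht.2, sub_le_self _ ht.1⟩
  obtain ⟨X, hXG, hX0, hX⟩ := RiccatiData.exists_forall_hasDerivWithinAt_field
    (θ := fun t => θ (T - t)) hT.le
    ((hθ Set.univ).comp (continuous_const.sub continuous_id).continuousOn (Set.mapsTo_univ _ _))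
    (fun t _ => hQ₁pos _) (fun t _ => hN _) hG₁
  refine ⟨fun t => X (T - t), fun t ht => hX0 _ (hmaps ht), by simpa using hXG,
    fun t ht => RiccatiData.nbar_posDef (hN t) (hX0 _ (hmaps ht)), fun t ht => ?_⟩
  intro i j
  have h := (hasDerivWithinAt_iff_apply.1 (hX _ (hmaps ht)) i j).scomp t
    ((hasDerivAt_id t).const_sub T).hasDerivWithinAt hmaps
  simp only [sub_sub_cancel, neg_smul, one_smul] at h
  exact h
end
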